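/- Suppose 0 < 1/m, 1/n ≪ ε ≪ ν ≪ ε_0 ≤ 1 and k ∈ ℕ∖{1}. Let V be a vertex set of size n. Suppose R = (ε_0/2, a^O, d_{a^O,k}) is a regularity instance and O = O(k−1, a^O) is an (ε_0, a^O, d_{a^O,k})-equitable partition of a k-graph H^(k) on V. Suppose there exists an (η, ε, a^P)-equitable family of partitions P = P(k−1, a^P) on V such that P ≺_ν O. Then there exists a family of partitions O' on V such that: (O'1) P ≺ O'; (O'2) O' is a (1/a_1^O, ε_0+ν^{1/20}, a^O, ν^{1/20})-equitable family of partitions and is an (ε_0+ν^{1/20}, d_{a^O,k})-partition of H^(k); (O'3) for each j ∈ [k−1] and each (x̂, b) ∈ Â(j, j−1, a^O) × [a_j^O], |O'^(j)(x̂,b) △ O^(j)(x̂,b)| ≤ ν^{1/2}·C(n,j). -/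

import Mathlib

namespace HypReg

open Finset

attribute [local instance 10] Classical.propDecidable

noncomputable section

variable {V : Type*} [DecidableEq V]

/-- Representation of a 1-graph: the set of singletons of `U`. -/
def sing (U : Finset V) : Finset (Finset V) :=
  U.image fun v => ({v} : Finset V)

/-- `Kset W j i B`: the i-element subsets of `W` all of whose j-element subsets lie in `B`. -/
def Kset (W : Finset V) (j i : ℕ) (B : Finset (Finset V)) : Finset (Finset V) :=
  (W.powersetCard i).filter fun S => ∀ T ∈ S.powersetCard j, T ∈ B

/-- Clique operator which, at level 1, uses the ambient family `cr` of crossing i-sets. -/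
def KsetC (W : Finset V) (cr : Finset (Finset V)) (j i : ℕ) (B : Finset (Finset V)) :
    Finset (Finset V) :=
  if j = 1 then cr.filter fun S => ∀ v ∈ S, ({v} : Finset V) ∈ B
  else Kset W j i B

/-- `A` (a (j+1)-graph) is (ε,d)-regular with respect to the j-graph `B` (plain clique sets). -/
def RegPair (W : Finset V) (j : ℕ) (ε d : ℝ) (A B : Finset (Finset V)) : Prop :=
  ∀ Q ⊆ B, ε * ((Kset W j (j+1) B).card : ℝ) ≤ ((Kset W j (j+1) Q).card : ℝ) →
    |((A ∩ Kset W j (j+1) Q).card : ℝ) - d * ((Kset W j (j+1) Q).card : ℝ)|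
      ≤ ε * ((Kset W j (j+1) Q).card : ℝ)

/-- (ε,d)-regularity with crossing-aware clique sets. -/
def RegPairC (W : Finset V) (cr : Finset (Finset V)) (j : ℕ) (ε d : ℝ)
    (A B : Finset (Finset V)) : Prop :=
  ∀ Q ⊆ B, ε * ((KsetC W cr j (j+1) B).card : ℝ) ≤ ((KsetC W cr j (j+1) Q).card : ℝ) →
    |((A ∩ KsetC W cr j (j+1) Q).card : ℝ) - d * ((KsetC W cr j (j+1) Q).card : ℝ)|
      ≤ ε * ((KsetC W cr j (j+1) Q).card : ℝ)

/-- Relative density `d(A | B)` of the (j+1)-graph `A` w.r.t. the j-graph `B`. -/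
def dens (W : Finset V) (cr : Finset (Finset V)) (j : ℕ) (A B : Finset (Finset V)) : ℝ :=
  if (KsetC W cr j (j+1) B).card = 0 then 0
  else ((A ∩ KsetC W cr j (j+1) B).card : ℝ) / ((KsetC W cr j (j+1) B).card : ℝ)

/-- `H` is a k-graph on the vertex set `W`. -/
def IsKGraph (W : Finset V) (k : ℕ) (H : Finset (Finset V)) : Prop :=
  ∀ e ∈ H, e ⊆ W ∧ e.card = k

/-- symmetric difference of two hypergraphs -/
def sd (A B : Finset (Finset V)) : Finset (Finset V) := (A \ B) ∪ (B \ A)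

/-- A (candidate) family of partitions: the ground set, the class of each vertex and,
for each level `j ≥ 2`, the class of each crossing j-set. -/
structure PartFam (V : Type*) [DecidableEq V] where
  gnd : Finset V
  vClass : V → Finset V
  cls : ℕ → Finset V → Finset (Finset V)

namespace PartFam

variable (F : PartFam V)

/-- crossing i-sets -/
def cross (i : ℕ) : Finset (Finset V) :=
  (F.gnd.powersetCard i).filter fun S =>
    ∀ u ∈ S, ∀ v ∈ S, u ≠ v → F.vClass u ≠ F.vClass v

/-- the level-j polyad of a vertex set `J` -/
def polyad (j : ℕ) (J : Finset V) : Finset (Finset V) :=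
  if j = 1 then sing (J.sup F.vClass) else (J.powersetCard j).sup (F.cls j)

/-- the clique set `K_j(P̂^{(j-1)}(J))` of the (j−1)-polyad of a crossing j-set `J` -/
def polyCliques (j : ℕ) (J : Finset V) : Finset (Finset V) :=
  KsetC F.gnd (F.cross j) (j-1) j (F.polyad (j-1) J)

/-- `F` is a family of partitions `P(k−1, a)`. -/
def IsFamily (k : ℕ) (a : ℕ → ℕ) : Prop :=
  (∀ v ∈ F.gnd, v ∈ F.vClass v) ∧
  (∀ v ∈ F.gnd, F.vClass v ⊆ F.gnd) ∧
  (∀ u ∈ F.gnd, ∀ v ∈ F.gnd, u ∈ F.vClass v → F.vClass u = F.vClass v) ∧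
  (F.gnd.image F.vClass).card = a 1 ∧ k ≤ a 1 ∧
  ∀ j, 2 ≤ j → j ≤ k - 1 →
    (∀ J ∈ F.cross j, J ∈ F.cls j J) ∧
    (∀ J ∈ F.cross j, ∀ I ∈ F.cls j J, F.cls j I = F.cls j J) ∧
    (∀ J ∈ F.cross j, F.cls j J ⊆ F.polyCliques j J) ∧
    (∀ J ∈ F.cross j, F.polyCliques j J ⊆ F.cross j) ∧
    (∀ J ∈ F.cross j, ((F.polyCliques j J).image (F.cls j)).card = a j)

/-- the regularity condition in the definition of an equitable family of partitions:
all polyad complexes of crossing k-sets are (ε, (1/a_2, …, 1/a_{k−1}))-regular. -/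
def PolyadReg (k : ℕ) (a : ℕ → ℕ) (ε : ℝ) : Prop :=
  ∀ K ∈ F.cross k, ∀ j, 2 ≤ j → j ≤ k - 1 → ∀ J ∈ K.powersetCard j,
    RegPairC F.gnd (F.cross j) (j-1) ε (1 / (a j : ℝ)) (F.polyad j K) (F.polyad (j-1) J)

/-- `(η, ε, a, λ)`-equitable family of partitions -/
def IsEquitable (k : ℕ) (a : ℕ → ℕ) (η ε lam : ℝ) : Prop :=
  1 ≤ η * (a 1 : ℝ) ∧
  (∀ v ∈ F.gnd, |((F.vClass v).card : ℝ) - (F.gnd.card : ℝ) / (a 1 : ℝ)|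
      ≤ lam * (F.gnd.card : ℝ) / (a 1 : ℝ)) ∧
  F.PolyadReg k a ε

/-- `(η, ε, a)`-equitable family of partitions (classes of size ⌊n/a₁⌋ or ⌊n/a₁⌋+1) -/
def IsEquitableE (k : ℕ) (a : ℕ → ℕ) (η ε : ℝ) : Prop :=
  1 ≤ η * (a 1 : ℝ) ∧
  (∀ v ∈ F.gnd, (F.vClass v).card = F.gnd.card / a 1 ∨
      (F.vClass v).card = F.gnd.card / a 1 + 1) ∧
  F.PolyadReg k a ε

/-- `G` is perfectly ε-regular with respect to `F`. -/
def PerfectlyRegular (k : ℕ) (ε : ℝ) (G : Finset (Finset V)) : Prop :=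
  ∀ K ∈ F.cross k, ∃ d : ℝ, 0 ≤ d ∧
    RegPairC F.gnd (F.cross k) (k-1) ε d G (F.polyad (k-1) K)

end PartFam

/-- `a` is a T-bounded vector of length k−1. -/
def BoundedVec (k T : ℕ) (a : ℕ → ℕ) : Prop := ∀ j, 1 ≤ j → j ≤ k - 1 → a j ≤ T

/-- level-j refinement `F^{(j)} ≺ P^{(j)}` between two families of partitions -/
def RefinesAt (F P : PartFam V) (j : ℕ) : Prop :=
  if j = 1 then ∀ v ∈ F.gnd, F.vClass v ⊆ P.vClass v
  else ∀ I ∈ F.cross j,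
    (∃ J ∈ P.cross j, F.cls j I ⊆ P.cls j J) ∨ ∀ S ∈ F.cls j I, S ∉ P.cross j

/-- level-j approximate refinement `F^{(j)} ≺_ν P^{(j)}` -/
def RefinesApproxAt (F P : PartFam V) (j : ℕ) (ν : ℝ) : Prop :=
  if j = 1 then
    ∃ f : Finset V → Finset V,
      (∀ v ∈ F.gnd, f (F.vClass v) ∈ F.gnd.image P.vClass) ∧
      ∑ C ∈ F.gnd.image F.vClass, ((C \ f C).card : ℝ) ≤ ν * (F.gnd.card : ℝ)
  else
    ∃ f : Finset (Finset V) → Finset (Finset V),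
      (∀ I ∈ F.cross j,
        f (F.cls j I) ∈ ((P.cross j).image (P.cls j)) ∪ {F.cross j \ P.cross j}) ∧
      ∑ C ∈ (F.cross j).image (F.cls j), ((C \ f C).card : ℝ) ≤ ν * ((F.cross j).card : ℝ)

/-- The address space: a base set (of class indices) together with a labelling of its subsets. -/
abbrev Addr := Finset ℕ × (Finset ℕ → ℕ)

/-- `x` is an element of the address space `Â(l, j, a)`. -/
def IsAddress (l j : ℕ) (a : ℕ → ℕ) (x : Addr) : Prop :=
  x.1.card = l ∧ (∀ i ∈ x.1, 1 ≤ i ∧ i ≤ a 1) ∧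
  (∀ L : Finset ℕ, L ⊆ x.1 → 2 ≤ L.card → L.card ≤ j → 1 ≤ x.2 L ∧ x.2 L ≤ a L.card) ∧
  (∀ L : Finset ℕ, ¬(L ⊆ x.1 ∧ 2 ≤ L.card ∧ L.card ≤ j) → x.2 L = 0)

/-- restriction `ŷ ≤ x̂` of an address to the base `B`, keeping levels up to `j`. -/
def restrictA (x : Addr) (j : ℕ) (B : Finset ℕ) : Addr :=
  (B, fun L => if L ⊆ B ∧ 2 ≤ L.card ∧ L.card ≤ j then x.2 L else 0)

/-- `d` is a density function of `Â(k, k−1, a)`. -/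
def DensityFun (k : ℕ) (a : ℕ → ℕ) (d : Addr → ℝ) : Prop :=
  ∀ x : Addr, IsAddress k (k-1) a x → 0 ≤ d x ∧ d x ≤ 1

/-- A family of partitions together with an `a`-labelling. -/
structure LabFam (V : Type*) [DecidableEq V] extends PartFam V where
  vIdx : V → ℕ
  lbl : ℕ → Finset V → ℕ

namespace LabFam

variable (F : LabFam V)

/-- `F` is a family of partitions with a legitimate `a`-labelling. -/
def IsLabeled (k : ℕ) (a : ℕ → ℕ) : Prop :=
  F.toPartFam.IsFamily k a ∧
  (∀ v ∈ F.gnd, 1 ≤ F.vIdx v ∧ F.vIdx v ≤ a 1) ∧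
  (∀ u ∈ F.gnd, ∀ v ∈ F.gnd, (F.vIdx u = F.vIdx v ↔ F.vClass u = F.vClass v)) ∧
  ∀ j, 2 ≤ j → j ≤ k - 1 →
    (∀ I ∈ F.toPartFam.cross j, 1 ≤ F.lbl j I ∧ F.lbl j I ≤ a j) ∧
    (∀ I ∈ F.toPartFam.cross j, ∀ I' ∈ F.cls j I, F.lbl j I' = F.lbl j I) ∧
    (∀ I ∈ F.toPartFam.cross j, ∀ I' ∈ F.toPartFam.cross j,
      F.toPartFam.polyad (j-1) I = F.toPartFam.polyad (j-1) I' →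
      F.lbl j I = F.lbl j I' → F.cls j I = F.cls j I')

/-- the address `x̂(L)` (up to level j) of a crossing set `L` -/
def addrOf (j : ℕ) (L : Finset V) : Addr :=
  (L.image F.vIdx,
   fun M => if M ⊆ L.image F.vIdx ∧ 2 ≤ M.card ∧ M.card ≤ j
     then F.lbl M.card (L.filter fun v => F.vIdx v ∈ M) else 0)

/-- the part `P^{(j)}(x̂, b)` -/
def partAt (j : ℕ) (x : Addr) (b : ℕ) : Finset (Finset V) :=
  if j ≤ 1 then (if x.1 = {b} then sing (F.gnd.filter fun v => F.vIdx v = b) else ∅)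
  else (F.toPartFam.cross j).filter fun I => F.addrOf (j-1) I = x ∧ F.lbl j I = b

/-- the polyad `P̂^{(j)}(x̂)` -/
def polyAt (j : ℕ) (x : Addr) : Finset (Finset V) :=
  if j = 1 then sing (F.gnd.filter fun v => F.vIdx v ∈ x.1)
  else (x.1.powersetCard j).sup fun B => F.partAt j (restrictA x (j-1) B) (x.2 B)

/-- `F` is an `(ε, d)`-partition of `H`. -/
def IsDensPartition (k : ℕ) (a : ℕ → ℕ) (ε : ℝ) (d : Addr → ℝ)
    (H : Finset (Finset V)) : Prop :=
  ∀ x : Addr, IsAddress k (k-1) a x →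
    RegPairC F.gnd (F.toPartFam.cross k) (k-1) ε (d x) H (F.polyAt (k-1) x)

/-- `F` is an `(ε, a, d)`-equitable partition of `H`. -/
def IsEquitPartition (k : ℕ) (a : ℕ → ℕ) (ε : ℝ) (d : Addr → ℝ)
    (H : Finset (Finset V)) : Prop :=
  F.IsLabeled k a ∧ F.toPartFam.IsEquitableE k a (1 / (a 1 : ℝ)) ε ∧
  F.IsDensPartition k a ε d H

end LabFam

/-- An ℓ-partite complex: vertex classes and, for each level, a partite graph. -/
structure Cx (V : Type*) [DecidableEq V] (l : ℕ) where
  C : Fin l → Finset V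
  G : ℕ → Finset (Finset V)

namespace Cx

variable {l : ℕ} (X : Cx V l)

def gnd : Finset V := Finset.univ.sup X.C

/-- crossing i-sets with respect to the classes of `X` -/
def cross (i : ℕ) : Finset (Finset V) :=
  (X.gnd.powersetCard i).filter fun S => ∀ t : Fin l, (S ∩ X.C t).card ≤ 1

/-- restriction of the level-j graph to the classes indexed by `L` -/
def restr (j : ℕ) (L : Finset (Fin l)) : Finset (Finset V) :=
  if j = 1 then sing (L.sup X.C) else (X.G j).filter fun e => e ⊆ L.sup X.C

/-- `X` is a complex with levels up to `k`. -/
def IsComplex (k : ℕ) : Prop :=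
  (∀ s t : Fin l, s ≠ t → Disjoint (X.C s) (X.C t)) ∧
  (∀ j, 2 ≤ j → j ≤ k → X.G j ⊆ X.cross j) ∧
  (∀ j, 3 ≤ j → j ≤ k → X.G j ⊆ Kset X.gnd (j-1) j (X.G (j-1)))

/-- `X` is an (ε, (d_2, …, d_k))-regular complex. -/
def IsRegular (k : ℕ) (ε : ℝ) (d : ℕ → ℝ) : Prop :=
  ∀ j, 2 ≤ j → j ≤ k → ∀ L ∈ (Finset.univ : Finset (Fin l)).powersetCard j,
    RegPairC X.gnd (X.cross j) (j-1) ε (d j) (X.G j) (X.restr (j-1) L)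

/-- The restricted complex `X[L]` is (ε, (d_2, …, d_{k−1}, p))-regular. -/
def RestrRegular (k : ℕ) (ε : ℝ) (d : ℕ → ℝ) (L : Finset (Fin l)) (p : ℝ) : Prop :=
  ∀ j, 2 ≤ j → j ≤ k → ∀ L' ∈ L.powersetCard j,
    RegPairC X.gnd (X.cross j) (j-1) ε (if j = k then p else d j)
      (X.restr j L) (X.restr (j-1) L')

/-- clique set `K_i` of the level-j graph of the complex (level 1: crossing sets). -/
def KsetLvl (j i : ℕ) : Finset (Finset V) :=
  if j ≤ 1 then X.cross i else Kset X.gnd j i (X.G j)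

end Cx

/-- `eCL`, `mCL` satisfy the counting lemma of Kohayakawa–Rödl–Skokan. -/
def CountingProp (eCL : ℝ → ℝ → ℕ → ℕ → ℝ) (mCL : ℝ → ℝ → ℕ → ℕ → ℕ) : Prop :=
  ∀ γ d₀ : ℝ, 0 < γ → 0 < d₀ → ∀ k l : ℕ, 2 ≤ k → k ≤ l →
    (0 < eCL γ d₀ k l ∧ eCL γ d₀ k l ≤ 1) ∧
    ∀ (V₀ : Type) [DecidableEq V₀], ∀ (X : Cx V₀ l) (m : ℕ) (lam ε : ℝ) (d : ℕ → ℝ),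
      0 ≤ lam → lam < 1/4 → 0 < ε → ε ≤ eCL γ d₀ k l → mCL γ d₀ k l ≤ m →
      (∀ j, 2 ≤ j → j ≤ k → d₀ ≤ d j) →
      X.IsComplex k →
      (∀ i, |((X.C i).card : ℝ) - (m : ℝ)| ≤ lam * m) →
      X.IsRegular k ε d →
      |((Kset X.gnd k l (X.G k)).card : ℝ) -
        (∏ j ∈ Finset.Icc 2 k, d j ^ (l.choose j)) * ∏ i, ((X.C i).card : ℝ)|
        ≤ γ * ((∏ j ∈ Finset.Icc 2 k, d j ^ (l.choose j)) * ∏ i, ((X.C i).card : ℝ))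

/-- `eRI` is a legitimate function for defining regularity instances. -/
def GoodERI (eRI : ℕ → ℕ → ℝ) : Prop :=
  (∀ t k : ℕ, 1 ≤ t → 2 ≤ k → 0 < eRI t k ∧ eRI t k ≤ 1) ∧
  (∀ k t t' : ℕ, 1 ≤ t → t ≤ t' → eRI t' k ≤ eRI t k) ∧
  (∀ t k k' : ℕ, 2 ≤ k → k ≤ k' → eRI t k' ≤ eRI t k) ∧
  (∀ k : ℕ, Filter.Tendsto (fun t => eRI t k) Filter.atTop (nhds 0)) ∧
  ∃ (eCL : ℝ → ℝ → ℕ → ℕ → ℝ) (mCL : ℝ → ℝ → ℕ → ℕ → ℕ),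
    CountingProp eCL mCL ∧
    ∀ t k : ℕ, 1 ≤ t → 2 ≤ k →
      eRI t k < eCL (1/(t:ℝ)) (1/(t:ℝ)) (k-1) k / (4 * (t:ℝ) ^ (4^k))

/-- `max_i a_i` over `i ∈ [k−1]` -/
def maxA (k : ℕ) (a : ℕ → ℕ) : ℕ := (Finset.Icc 1 (k-1)).sup a

/-- `(ε, a, d)` is a regularity instance. -/
def RegInstance (eRI : ℕ → ℕ → ℝ) (k : ℕ) (ε : ℝ) (a : ℕ → ℕ) (d : Addr → ℝ) : Prop :=
  2 ≤ k ∧ (∀ j, 1 ≤ j → j ≤ k - 1 → 1 ≤ a j) ∧ 0 < ε ∧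
  ε ≤ eRI (maxA k a) k ∧ DensityFun k a d

section Counting

variable {W : Type} [Fintype W] [DecidableEq W]

/-- `S` spans an induced copy of `Fg` in `H` (both k-graphs). -/
def InducedCopy (Fg : Finset (Finset W)) (H : Finset (Finset V)) (k : ℕ) (S : Finset V) :
    Prop :=
  ∃ e : W → V, Function.Injective e ∧ Finset.univ.image e = S ∧
    ∀ A : Finset W, A.card = k → (A.image e ∈ H ↔ A ∈ Fg)

/-- the size of the automorphism group of `Fg` -/
def AutCount (Fg : Finset (Finset W)) : ℕ :=
  Nat.card {π : W ≃ W // ∀ A : Finset W, A.image π ∈ Fg ↔ A ∈ Fg}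

/-- the number `IC_σ(F, H)` of σ-induced copies of `Fg` in the complex `X` -/
def ICosig {l : ℕ} (X : Cx V l) (k : ℕ) (Fg : Finset (Finset W)) (σ : W ≃ Fin l) : ℕ :=
  Set.ncard {e : W → V |
    (∀ v, e v ∈ X.C (σ v)) ∧
    Finset.univ.image e ∈ X.KsetLvl (k-1) l ∧
    ∀ A : Finset W, A.card = k → (A.image e ∈ X.G k ↔ A ∈ Fg)}

/-- `IC(F, d, x̂, σ)` -/
def ICs (Fg : Finset (Finset W)) (k l : ℕ) (a : ℕ → ℕ) (d : Addr → ℝ)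
    (x : Addr) (σ : W → ℕ) : ℝ :=
  (∏ B ∈ x.1.powersetCard k,
    if ∃ A ∈ Fg, A.image σ = B then d (restrictA x (k-1) B)
    else 1 - d (restrictA x (k-1) B)) *
  ∏ j ∈ Finset.Icc 2 (k-1), ((a j : ℝ) ^ (l.choose j))⁻¹

/-- `IC(F, d, x̂)` -/
def ICa (Fg : Finset (Finset W)) (k l : ℕ) (a : ℕ → ℕ) (d : Addr → ℝ) (x : Addr) : ℝ :=
  (AutCount Fg : ℝ)⁻¹ *
    ∑ᶠ σ ∈ {σ : W → ℕ | Set.BijOn σ Set.univ ↑x.1}, ICs Fg k l a d x σ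

/-- `IC(F, d)` -/
def IC (Fg : Finset (Finset W)) (k l : ℕ) (a : ℕ → ℕ) (d : Addr → ℝ) : ℝ :=
  (((a 1).choose l : ℝ))⁻¹ * ∑ᶠ x ∈ {x : Addr | IsAddress l (k-1) a x}, ICa Fg k l a d x

end Counting

end

end HypReg

namespace HypReg

open Finset

attribute [local instance 10] Classical.propDecidable

noncomputable section

namespace LabFam

variable {V : Type*} [DecidableEq V]

/-- Two vertices carry the same index exactly when they lie in the same class. -/
def Coherent (F : LabFam V) : Prop :=
  ∀ u ∈ F.gnd, ∀ v ∈ F.gnd, (F.vIdx u = F.vIdx v ↔ F.vClass u = F.vClass v)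

/-- The labels of `S` and of its subsets of size at most `j` are those prescribed by `x`. -/
def Fits (F : LabFam V) (j : ℕ) (x : Addr) (S : Finset V) : Prop :=
  (∀ v ∈ S, F.vIdx v ∈ x.1) ∧
  ∀ T ⊆ S, 2 ≤ T.card → T.card ≤ j → F.lbl T.card T = x.2 (T.image F.vIdx)

/-- The crossing `i`-sets whose labels up to level `j` are prescribed by `x`. -/
def cliq (F : LabFam V) (j i : ℕ) (x : Addr) : Finset (Finset V) :=
  (F.toPartFam.cross i).filter (F.Fits j x)

/-- The part of `S` in the classes indexed by `M`. -/
def slice (F : LabFam V) (S : Finset V) (M : Finset ℕ) : Finset V :=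
  S.filter fun v => F.vIdx v ∈ M

variable {F : LabFam V}

theorem mem_cliq {j i : ℕ} {x : Addr} {S : Finset V} :
    S ∈ F.cliq j i x ↔ S ∈ F.toPartFam.cross i ∧ F.Fits j x S := by
  simp [cliq]

theorem mem_cross (hF : F.Coherent) {i : ℕ} {S : Finset V} :
    S ∈ F.toPartFam.cross i ↔ S ⊆ F.gnd ∧ S.card = i ∧ Set.InjOn F.vIdx S := by
  simp only [PartFam.cross, mem_filter, mem_powersetCard, and_assoc]
  refine and_congr_right fun hS => and_congr_right fun _ => ⟨fun h u hu v hv huv => ?_, ?_⟩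
  · by_contra hne
    exact h u hu v hv hne ((hF u (hS hu) v (hS hv)).1 huv)
  · intro h u hu v hv hne he
    exact hne (h hu hv ((hF u (hS hu) v (hS hv)).2 he))

theorem cross_subset (hF : F.Coherent) {i : ℕ} {S T : Finset V}
    (hS : S ∈ F.toPartFam.cross i) (hT : T ⊆ S) : T ∈ F.toPartFam.cross T.card := by
  rw [mem_cross hF] at *
  exact ⟨hT.trans hS.1, rfl, hS.2.2.mono (by exact_mod_cast hT)⟩

theorem card_image_of_cross (hF : F.Coherent) {i : ℕ} {S : Finset V}
    (hS : S ∈ F.toPartFam.cross i) : (S.image F.vIdx).card = i := by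
  rw [mem_cross hF] at hS
  rw [card_image_of_injOn hS.2.2, hS.2.1]

theorem slice_subset (S : Finset V) (M : Finset ℕ) : F.slice S M ⊆ S := filter_subset _ _

theorem image_slice {S : Finset V} {M : Finset ℕ} (hM : M ⊆ S.image F.vIdx) :
    (F.slice S M).image F.vIdx = M := by
  ext b
  simp only [slice, mem_image, mem_filter]
  constructor
  · rintro ⟨v, ⟨_, h⟩, rfl⟩
    exact h
  · intro hb
    obtain ⟨v, hv, rfl⟩ := mem_image.1 (hM hb)
    exact ⟨v, ⟨hv, hb⟩, rfl⟩

theorem card_slice {S : Finset V} {M : Finset ℕ} (hS : Set.InjOn F.vIdx S)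
    (hM : M ⊆ S.image F.vIdx) : (F.slice S M).card = M.card := by
  conv_rhs => rw [← image_slice hM]
  exact (card_image_of_injOn (hS.mono (by exact_mod_cast slice_subset S M))).symm

theorem slice_image {S T : Finset V} (hS : Set.InjOn F.vIdx S) (hT : T ⊆ S) :
    F.slice S (T.image F.vIdx) = T := by
  ext v
  simp only [slice, mem_image, mem_filter]
  constructor
  · rintro ⟨hv, u, hu, huv⟩
    exact hS (hT hu) hv huv ▸ hu
  · intro hv
    exact ⟨hT hv, v, hv, rfl⟩

theorem addrOf_snd {j : ℕ} {S : Finset V} {M : Finset ℕ} (hM : M ⊆ S.image F.vIdx)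
    (h2 : 2 ≤ M.card) (hj : M.card ≤ j) :
    (F.addrOf j S).2 M = F.lbl M.card (F.slice S M) := by
  simp only [addrOf, slice]
  rw [if_pos ⟨hM, h2, hj⟩]

theorem Fits.mono {j j' : ℕ} {x : Addr} {S T : Finset V} (h : F.Fits j x S) (hT : T ⊆ S)
    (hj : j' ≤ j) : F.Fits j' x T :=
  ⟨fun v hv => h.1 v (hT hv), fun U hU h2 hc => h.2 U (hU.trans hT) h2 (hc.trans hj)⟩

theorem Fits.image_subset {j : ℕ} {x : Addr} {S : Finset V} (h : F.Fits j x S) :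
    S.image F.vIdx ⊆ x.1 := by
  intro b hb
  obtain ⟨v, hv, rfl⟩ := mem_image.1 hb
  exact h.1 v hv

theorem Fits.congr {j : ℕ} {x y : Addr} {S : Finset V} (hS : Set.InjOn F.vIdx S)
    (h : F.Fits j x S) (h1 : S.image F.vIdx ⊆ y.1)
    (h2 : ∀ M ⊆ S.image F.vIdx, 2 ≤ M.card → M.card ≤ j → x.2 M = y.2 M) : F.Fits j y S := by
  refine ⟨fun v hv => h1 (mem_image_of_mem _ hv), fun T hT hT2 hTj => ?_⟩
  have hc : (T.image F.vIdx).card = T.card :=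
    card_image_of_injOn (hS.mono (by exact_mod_cast hT))
  rw [h.2 T hT hT2 hTj]
  exact h2 _ (image_subset_image hT) (by omega) (by omega)

theorem fits_addrOf {j j' : ℕ} {S : Finset V} (hS : Set.InjOn F.vIdx S) (hj : j ≤ j') :
    F.Fits j (F.addrOf j' S) S := by
  refine ⟨fun v hv => mem_image_of_mem _ hv, fun T hT hT2 hTj => ?_⟩
  have hc : (T.image F.vIdx).card = T.card :=
    card_image_of_injOn (hS.mono (by exact_mod_cast hT))
  rw [addrOf_snd (image_subset_image hT) (by omega) (by omega), slice_image hS hT, hc]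

theorem addrOf_snd_of_fits {j j' : ℕ} {x : Addr} {S : Finset V} {M : Finset ℕ}
    (hS : Set.InjOn F.vIdx S) (h : F.Fits j x S) (hM : M ⊆ S.image F.vIdx)
    (h2 : 2 ≤ M.card) (hj : M.card ≤ j) (hj' : M.card ≤ j') : (F.addrOf j' S).2 M = x.2 M := by
  have hc := card_slice hS hM
  have := h.2 (F.slice S M) (slice_subset S M) (by omega) (by omega)
  rw [addrOf_snd hM h2 hj', ← hc, this, image_slice hM]

/-- `cliq` only depends on the labels prescribed on subsets of the base. -/
theorem cliq_congr (hF : F.Coherent) {j i : ℕ} {x y : Addr} (h1 : x.1 = y.1)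
    (h2 : ∀ M ⊆ x.1, 2 ≤ M.card → M.card ≤ j → x.2 M = y.2 M) :
    F.cliq j i x = F.cliq j i y := by
  ext S
  simp only [mem_cliq]
  refine and_congr_right fun hS => ?_
  have hi := ((mem_cross hF).1 hS).2.2
  constructor
  · intro h
    exact h.congr hi (h1 ▸ h.image_subset) fun M hM => h2 M (hM.trans h.image_subset)
  · intro h
    exact h.congr hi (h1 ▸ h.image_subset) fun M hM a b =>
      (h2 M (h1 ▸ hM.trans h.image_subset) a b).symm

theorem cliq_mono {j j' i : ℕ} (x : Addr) (hj : j ≤ j') : F.cliq j' i x ⊆ F.cliq j i x := by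
  intro S hS
  rw [mem_cliq] at *
  exact ⟨hS.1, hS.2.mono subset_rfl hj⟩

theorem cliq_subset_powersetCard {j i : ℕ} (x : Addr) :
    F.cliq j i x ⊆ F.gnd.powersetCard i := by
  intro S hS
  rw [mem_cliq, PartFam.cross, mem_filter] at hS
  exact hS.1.1

theorem mem_cliq_of_subset (hF : F.Coherent) {j i j' : ℕ} {x : Addr} {S T : Finset V}
    (h : S ∈ F.cliq j i x) (hT : T ⊆ S) (hj : j' ≤ j) : T ∈ F.cliq j' T.card x := by
  rw [mem_cliq] at *
  exact ⟨cross_subset hF h.1 hT, h.2.mono hT hj⟩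

theorem slice_mem_cliq (hF : F.Coherent) {j i j' : ℕ} {x : Addr} {S : Finset V} {B : Finset ℕ}
    (h : S ∈ F.cliq j i x) (hB : B ⊆ S.image F.vIdx) (hj : j' ≤ j) :
    F.slice S B ∈ F.cliq j' B.card (B, x.2) := by
  have hi := ((mem_cross hF).1 (mem_cliq.1 h).1).2.2
  have := mem_cliq_of_subset hF h (slice_subset (F := F) S B) hj
  rw [card_slice hi hB, mem_cliq] at this
  rw [mem_cliq]
  refine ⟨this.1, this.2.congr (hi.mono (by exact_mod_cast slice_subset S B)) ?_ ?_⟩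
  · rw [image_slice hB]
  · intros; rfl

theorem image_eq_of_mem_cliq (hF : F.Coherent) {j i : ℕ} {x : Addr} {S : Finset V}
    (h : S ∈ F.cliq j i x) (hx : x.1.card = i) : S.image F.vIdx = x.1 := by
  rw [mem_cliq] at h
  exact eq_of_subset_of_card_le h.2.image_subset (by rw [card_image_of_cross hF h.1, hx])

theorem mem_sing {U S : Finset V} : S ∈ sing U ↔ ∃ v ∈ U, {v} = S := by
  simp [sing]

theorem singleton_mem_sing {U : Finset V} {v : V} : {v} ∈ sing U ↔ v ∈ U := by
  simp [sing]

theorem fits_singleton {j : ℕ} {x : Addr} {v : V} : F.Fits j x {v} ↔ F.vIdx v ∈ x.1 := by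
  constructor
  · intro h; exact h.1 v (mem_singleton_self v)
  · intro h
    refine ⟨by simpa using h, fun T hT h2 => ?_⟩
    have := card_le_card hT
    simp at this; omega

theorem cliq_one (hF : F.Coherent) (j : ℕ) (x : Addr) :
    F.cliq j 1 x = sing (F.gnd.filter fun v => F.vIdx v ∈ x.1) := by
  ext S
  rw [mem_cliq, mem_cross hF, mem_sing]
  constructor
  · rintro ⟨⟨hS, hc, _⟩, hf⟩
    obtain ⟨v, rfl⟩ := card_eq_one.1 hc
    exact ⟨v, mem_filter.2 ⟨hS (mem_singleton_self v), fits_singleton.1 hf⟩, rfl⟩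
  · rintro ⟨v, hv, rfl⟩
    rw [mem_filter] at hv
    exact ⟨⟨by simpa using hv.1, by simp, by simp⟩, fits_singleton.2 hv.2⟩

theorem mem_partAt (hF : F.Coherent) {j : ℕ} (hj : 2 ≤ j) {x : Addr} {B : Finset ℕ} {b : ℕ}
    (hB : B.card = j) {S : Finset V} :
    S ∈ F.partAt j (restrictA x (j-1) B) b ↔
      S ∈ F.cliq (j-1) j (B, x.2) ∧ F.lbl j S = b := by
  rw [partAt, if_neg (by omega), mem_filter, mem_cliq, and_assoc]
  refine and_congr_right fun hS => and_congr_left fun _ => ?_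
  have hi := ((mem_cross hF).1 hS).2.2
  constructor
  · intro h
    have h1 : S.image F.vIdx = B := congrArg Prod.fst h
    refine (fits_addrOf hi (le_refl (j-1))).congr hi (by rw [h1]) fun M hM h2 hj' => ?_
    rw [h]
    simp only [restrictA]
    rw [if_pos ⟨h1 ▸ hM, h2, hj'⟩]
  · intro h
    have h1 : S.image F.vIdx = B :=
      eq_of_subset_of_card_le h.image_subset (by rw [card_image_of_cross hF hS, hB])
    refine Prod.ext h1 (funext fun M => ?_)
    by_cases hM : M ⊆ B ∧ 2 ≤ M.card ∧ M.card ≤ j - 1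
    · rw [addrOf_snd_of_fits hi h (h1 ▸ hM.1) hM.2.1 hM.2.2 hM.2.2]
      simp only [restrictA]
      rw [if_pos hM]
    · simp only [restrictA, addrOf]
      rw [if_neg hM, h1, if_neg hM]

theorem fits_succ (hF : F.Coherent) {j : ℕ} (hj : 2 ≤ j) {x : Addr} {S : Finset V}
    (hS : S ∈ F.toPartFam.cross j) :
    F.Fits j x S ↔ F.Fits (j-1) x S ∧ F.lbl j S = x.2 (S.image F.vIdx) := by
  have hc := ((mem_cross hF).1 hS).2.1
  constructor
  · intro h
    refine ⟨h.mono subset_rfl (by omega), ?_⟩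
    have := h.2 S subset_rfl (by omega) (by omega)
    rwa [hc] at this
  · rintro ⟨h, hl⟩
    refine ⟨h.1, fun T hT h2 hTj => ?_⟩
    rcases Nat.lt_or_ge T.card j with hlt | hge
    · exact h.2 T hT h2 (by omega)
    · rw [eq_of_subset_of_card_le hT (by omega), hc, hl]

theorem polyAt_eq_cliq (hF : F.Coherent) {j : ℕ} (hj : 1 ≤ j) (x : Addr) :
    F.polyAt j x = F.cliq j j x := by
  rcases Nat.eq_or_lt_of_le hj with rfl | hj
  · rw [cliq_one hF, polyAt, if_pos rfl]
  · ext S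
    rw [polyAt, if_neg (by omega), mem_sup]
    constructor
    · rintro ⟨B, hB, hS⟩
      rw [mem_powersetCard] at hB
      rw [mem_partAt hF hj hB.2] at hS
      have hi := ((mem_cross hF).1 (mem_cliq.1 hS.1).1).2.2
      have h1 := image_eq_of_mem_cliq hF hS.1 hB.2
      dsimp only at h1
      rw [mem_cliq] at hS ⊢
      refine ⟨hS.1.1, (fits_succ hF hj hS.1.1).2 ⟨hS.1.2.congr hi (h1 ▸ hB.1) ?_, ?_⟩⟩
      · intros; rfl
      · rw [hS.2, h1]
    · intro hS
      have hS' := mem_cliq.1 hS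
      have hi := ((mem_cross hF).1 hS'.1).2.2
      have hc := card_image_of_cross hF hS'.1
      refine ⟨S.image F.vIdx, mem_powersetCard.2 ⟨hS'.2.image_subset, hc⟩, ?_⟩
      rw [mem_partAt hF hj hc, mem_cliq]
      have := (fits_succ hF hj hS'.1).1 hS'.2
      refine ⟨⟨hS'.1, this.1.congr hi subset_rfl ?_⟩, this.2⟩
      intros; rfl

/-- The clique set of a polyad. -/
theorem KsetC_cliq (hF : F.Coherent) {j i : ℕ} (hj : 1 ≤ j) (hji : j ≤ i) (x : Addr) :
    KsetC F.gnd (F.toPartFam.cross (i+1)) i (i+1) (F.cliq j i x) = F.cliq j (i+1) x := by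
  ext S
  rcases Nat.eq_or_lt_of_le (hj.trans hji) with rfl | hi
  · obtain rfl : j = 1 := by omega
    rw [KsetC, if_pos rfl, mem_filter, mem_cliq, cliq_one hF]
    refine and_congr_right fun hS => ?_
    have hW := ((mem_cross hF).1 hS).1
    simp only [singleton_mem_sing, mem_filter]
    constructor
    · intro h
      exact ⟨fun v hv => (h v hv).2, fun T _ h2 h1 => by omega⟩
    · intro h v hv
      exact ⟨hW hv, h.1 v hv⟩
  · rw [KsetC, if_neg (by omega), Kset, mem_filter, mem_powersetCard]
    constructor
    · rintro ⟨⟨hW, hc⟩, h⟩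
      have key : ∀ U ⊆ S, U.card ≤ i → ∃ T ⊆ S, U ⊆ T ∧ T ∈ F.cliq j i x := by
        intro U hU hUc
        obtain ⟨T, hUT, hTS, hTc⟩ := exists_subsuperset_card_eq hU hUc (by omega)
        exact ⟨T, hTS, hUT, h T (mem_powersetCard.2 ⟨hTS, hTc⟩)⟩
      rw [mem_cliq, mem_cross hF]
      refine ⟨⟨hW, hc, ?_⟩, ?_, ?_⟩
      · intro u hu v hv huv
        obtain ⟨T, _, hUT, hT⟩ := key {u, v} (by
          intro w hw; simp at hw; rcases hw with rfl | rfl <;> assumption)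
          (card_le_two.trans hi)
        exact ((mem_cross hF).1 (mem_cliq.1 hT).1).2.2
          (hUT (by simp)) (hUT (by simp)) huv
      · intro v hv
        obtain ⟨T, _, hUT, hT⟩ := key {v} (by simpa using hv) (by simp; omega)
        exact (mem_cliq.1 hT).2.1 v (hUT (by simp))
      · intro U hU h2 hUj
        obtain ⟨T, _, hUT, hT⟩ := key U hU (by omega)
        exact (mem_cliq.1 hT).2.2 U hUT h2 hUj
    · intro hS
      have hS' := (mem_cross hF).1 (mem_cliq.1 hS).1
      refine ⟨⟨hS'.1, hS'.2.1⟩, fun T hT => ?_⟩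
      rw [mem_powersetCard] at hT
      have := mem_cliq_of_subset hF hS hT.1 (le_refl j)
      rwa [hT.2] at this

end LabFam

end

end HypReg

namespace HypReg

open Finset

attribute [local instance 10] Classical.propDecidable

noncomputable section

namespace LabFam

variable {V : Type*} [DecidableEq V] {F : LabFam V}

/-- The vertex classes are the fibres of the index function. -/
def VertexCanon (F : LabFam V) : Prop :=
  ∀ v ∈ F.gnd, F.vClass v = F.gnd.filter fun u => F.vIdx u = F.vIdx v

/-- At level `j` the parts are exactly the sets of crossing `j`-sets with a given address. -/
def LevelCanon (F : LabFam V) (j : ℕ) : Prop :=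
  ∀ J ∈ F.toPartFam.cross j, F.cls j J = F.cliq j j (F.addrOf j J)

theorem VertexCanon.coherent (hv : F.VertexCanon) : F.Coherent := by
  intro u hu v hv'
  rw [hv u hu, hv v hv']
  constructor
  · intro h; rw [h]
  · intro h
    have : u ∈ F.gnd.filter fun w => F.vIdx w = F.vIdx v := by
      rw [← h]; simp [hu]
    exact (mem_filter.1 this).2

theorem polyad_eq_cliq (hv : F.VertexCanon) {j i : ℕ} (hj : 1 ≤ j)
    (hc : 2 ≤ j → F.LevelCanon j) {x : Addr} {K : Finset V}
    (hK : K ∈ F.toPartFam.cross i) (hfit : F.Fits j x K) (h1 : K.image F.vIdx = x.1) :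
    F.toPartFam.polyad j K = F.cliq j j x := by
  have hF := hv.coherent
  have hK' := (mem_cross hF).1 hK
  rcases Nat.eq_or_lt_of_le hj with rfl | hj
  · rw [PartFam.polyad, if_pos rfl, cliq_one hF]
    congr 1
    ext u
    rw [mem_sup, mem_filter, ← h1, mem_image]
    constructor
    · rintro ⟨v, hvK, hu⟩
      rw [hv v (hK'.1 hvK), mem_filter] at hu
      exact ⟨hu.1, v, hvK, hu.2.symm⟩
    · rintro ⟨hu, v, hvK, he⟩
      refine ⟨v, hvK, ?_⟩
      rw [hv v (hK'.1 hvK), mem_filter]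
      exact ⟨hu, he.symm⟩
  · rw [PartFam.polyad, if_neg (by omega)]
    ext S
    rw [mem_sup]
    constructor
    · rintro ⟨T, hT, hS⟩
      rw [mem_powersetCard] at hT
      have hTc := cross_subset hF hK hT.1
      rw [hT.2] at hTc
      rw [hc hj T hTc] at hS
      have him := image_eq_of_mem_cliq hF hS (card_image_of_cross hF hTc)
      rw [mem_cliq] at hS ⊢
      have hi := ((mem_cross hF).1 hS.1).2.2
      have hTK := image_subset_image (f := F.vIdx) hT.1
      refine ⟨hS.1, hS.2.congr hi (him ▸ h1 ▸ hTK) fun M hM h2 hMj => ?_⟩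
      exact addrOf_snd_of_fits ((mem_cross hF).1 hTc).2.2 (hfit.mono hT.1 le_rfl)
        (hM.trans him.subset) h2 hMj hMj
    · intro hS
      have hS' := mem_cliq.1 hS
      have hi := ((mem_cross hF).1 hS'.1).2.2
      have hsub : S.image F.vIdx ⊆ K.image F.vIdx := h1 ▸ hS'.2.image_subset
      have hcard := card_slice hK'.2.2 hsub
      rw [card_image_of_cross hF hS'.1] at hcard
      have hTc := cross_subset hF hK (slice_subset (F := F) K (S.image F.vIdx))
      rw [hcard] at hTc
      refine ⟨F.slice K (S.image F.vIdx),
        mem_powersetCard.2 ⟨slice_subset _ _, hcard⟩, ?_⟩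
      rw [hc hj _ hTc, mem_cliq]
      have him := image_slice hsub
      refine ⟨hS'.1, hS'.2.congr hi him.superset fun M hM h2 hMj => ?_⟩
      exact (addrOf_snd_of_fits ((mem_cross hF).1 hTc).2.2
        (hfit.mono (slice_subset _ _) le_rfl) (hM.trans him.superset) h2 hMj hMj).symm

theorem polyCliques_eq_cliq (hv : F.VertexCanon) {j : ℕ} (hj : 2 ≤ j)
    (hc : 2 ≤ j - 1 → F.LevelCanon (j-1)) {J : Finset V} (hJ : J ∈ F.toPartFam.cross j) :
    F.toPartFam.polyCliques j J = F.cliq (j-1) j (F.addrOf (j-1) J) := by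
  have hF := hv.coherent
  have hJ' := (mem_cross hF).1 hJ
  rw [PartFam.polyCliques, polyad_eq_cliq hv (by omega) hc hJ
    (fits_addrOf hJ'.2.2 le_rfl) rfl]
  obtain ⟨i, rfl⟩ : ∃ i, j = i + 1 := ⟨j - 1, by omega⟩
  exact KsetC_cliq hF (by omega) le_rfl _

theorem cliq_succ_addrOf (hF : F.Coherent) {j : ℕ} (hj : 2 ≤ j) {I J : Finset V}
    (hJ : J ∈ F.toPartFam.cross j) :
    I ∈ F.cliq j j (F.addrOf j J) ↔
      I ∈ F.cliq (j-1) j (F.addrOf (j-1) J) ∧ F.lbl j I = F.lbl j J := by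
  have hJ' := (mem_cross hF).1 hJ
  have hcJ := card_image_of_cross hF hJ
  rw [cliq_congr hF (x := F.addrOf (j-1) J) (y := F.addrOf j J) rfl]
  · constructor
    · intro h
      have him := image_eq_of_mem_cliq hF h hcJ
      rw [mem_cliq] at h ⊢
      have h2 := (fits_succ hF hj h.1).1 h.2
      refine ⟨⟨h.1, h2.1⟩, ?_⟩
      rw [h2.2, him]
      have h3 := ((fits_succ hF hj hJ).1 (fits_addrOf hJ'.2.2 le_rfl)).2
      exact h3.symm
    · rintro ⟨h, hl⟩
      have him := image_eq_of_mem_cliq hF h hcJ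
      rw [mem_cliq] at h ⊢
      refine ⟨h.1, (fits_succ hF hj h.1).2 ⟨h.2, ?_⟩⟩
      have h3 := ((fits_succ hF hj hJ).1 (fits_addrOf hJ'.2.2 le_rfl)).2
      rw [hl, him, h3]
      rfl
  · intro M hM h2 hMj
    exact addrOf_snd_of_fits hJ'.2.2 (fits_addrOf hJ'.2.2 le_rfl) hM h2 hMj hMj
      |>.trans (addrOf_snd_of_fits hJ'.2.2 (fits_addrOf hJ'.2.2 le_rfl) hM h2 (by omega)
        (by omega)) |>.trans rfl

theorem IsLabeled.vertexCanon {k : ℕ} {a : ℕ → ℕ} (h : F.IsLabeled k a) : F.VertexCanon := by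
  obtain ⟨⟨h1, h2, h3, -⟩, -, h4, -⟩ := h
  intro v hv
  ext u
  rw [mem_filter]
  constructor
  · intro hu
    have hu' := h2 v hv hu
    exact ⟨hu', (h4 u hu' v hv).2 (h3 u hu' v hv hu)⟩
  · rintro ⟨hu, he⟩
    rw [← (h4 u hu v hv).1 he]
    exact h1 u hu

theorem IsLabeled.levelCanon {k : ℕ} {a : ℕ → ℕ} (h : F.IsLabeled k a) (j : ℕ) :
    2 ≤ j → j ≤ k - 1 → F.LevelCanon j := by
  have hv := h.vertexCanon
  have hF := hv.coherent
  obtain ⟨⟨-, -, -, -, -, hfam⟩, -, -, hlab⟩ := h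
  induction j with
  | zero => intro h; omega
  | succ i ih =>
    intro hi hik J hJ
    obtain ⟨f1, f2, f3, f4, -⟩ := hfam (i+1) hi hik
    obtain ⟨l1, l2, l3⟩ := hlab (i+1) hi hik
    have hc : 2 ≤ i + 1 - 1 → F.LevelCanon (i+1-1) := fun h => ih h (by omega)
    have hpc := polyCliques_eq_cliq hv hi hc hJ
    ext I
    rw [cliq_succ_addrOf hF hi hJ]
    constructor
    · intro hI
      exact ⟨hpc ▸ f3 J hJ hI, l2 J hJ I hI⟩
    · rintro ⟨hI, hl⟩
      have him := image_eq_of_mem_cliq hF hI (card_image_of_cross hF hJ)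
      rw [mem_cliq] at hI
      have e1 := polyad_eq_cliq hv (by omega) hc hI.1 hI.2 him
      have e2 := polyad_eq_cliq hv (by omega) hc hJ
        (fits_addrOf ((mem_cross hF).1 hJ).2.2 (le_refl (i+1-1))) rfl
      rw [← l3 I hI.1 J hJ (e1.trans e2.symm) hl]
      exact f1 I hI.1

theorem card_image_eq_of_fibres {α β γ : Type*} [DecidableEq β] [DecidableEq γ] (s : Finset α)
    (f : α → β) (g : α → γ) (h : ∀ a ∈ s, ∀ b ∈ s, f a = f b ↔ g a = g b) :
    (s.image f).card = (s.image g).card := by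
  have e1 : s.image f = (s.image fun a => (f a, g a)).image Prod.fst := by
    rw [image_image]; rfl
  have e2 : s.image g = (s.image fun a => (f a, g a)).image Prod.snd := by
    rw [image_image]; rfl
  rw [e1, e2, card_image_of_injOn, card_image_of_injOn (f := Prod.snd)]
  all_goals
    intro p hp q hq hpq
    obtain ⟨a, ha, rfl⟩ := mem_image.1 (mem_coe.1 hp)
    obtain ⟨b, hb, rfl⟩ := mem_image.1 (mem_coe.1 hq)
  · exact Prod.ext ((h a ha b hb).2 hpq) hpq
  · exact Prod.ext hpq ((h a ha b hb).1 hpq)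

theorem IsLabeled.exists_vIdx {k : ℕ} {a : ℕ → ℕ} (h : F.IsLabeled k a) {b : ℕ}
    (hb : b ∈ Icc 1 (a 1)) : ∃ v ∈ F.gnd, F.vIdx v = b := by
  obtain ⟨⟨-, -, -, h1, -, -⟩, h2, h3, -⟩ := h
  rw [card_image_eq_of_fibres F.gnd F.vClass F.vIdx
    fun u hu v hv => (h3 u hu v hv).symm] at h1
  have : F.gnd.image F.vIdx = Icc 1 (a 1) := by
    refine eq_of_subset_of_card_le ?_ (by simp [h1])
    intro c hc
    obtain ⟨v, hv, rfl⟩ := mem_image.1 hc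
    exact mem_Icc.2 (h2 v hv)
  rw [← this] at hb
  exact mem_image.1 hb

theorem IsLabeled.exists_lbl {k : ℕ} {a : ℕ → ℕ} (h : F.IsLabeled k a) {j : ℕ} (hj : 2 ≤ j)
    (hjk : j ≤ k - 1) {J : Finset V} (hJ : J ∈ F.toPartFam.cross j) {b : ℕ}
    (hb : b ∈ Icc 1 (a j)) : ∃ I ∈ F.cliq (j-1) j (F.addrOf (j-1) J), F.lbl j I = b := by
  have hv := h.vertexCanon
  have hF := hv.coherent
  have hc : 2 ≤ j - 1 → F.LevelCanon (j-1) := fun h2 => h.levelCanon _ h2 (by omega)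
  have hpc := polyCliques_eq_cliq hv hj hc hJ
  have hlev := h.levelCanon j hj hjk
  obtain ⟨⟨-, -, -, -, -, hfam⟩, -, -, hlab⟩ := h
  obtain ⟨f1, f2, f3, f4, f5⟩ := hfam j hj hjk
  obtain ⟨l1, l2, l3⟩ := hlab j hj hjk
  have h1 := f5 J hJ
  rw [hpc] at h1
  rw [card_image_eq_of_fibres _ _ (F.lbl j)] at h1
  · have : (F.cliq (j-1) j (F.addrOf (j-1) J)).image (F.lbl j) = Icc 1 (a j) := by
      refine eq_of_subset_of_card_le ?_ (by simp [h1])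
      intro c hc
      obtain ⟨I, hI, rfl⟩ := mem_image.1 hc
      exact mem_Icc.2 (l1 I (mem_cliq.1 hI).1)
    rw [← this] at hb
    exact mem_image.1 hb
  · intro I hI I' hI'
    have c1 := (mem_cliq.1 hI).1
    have c2 := (mem_cliq.1 hI').1
    constructor
    · intro he
      exact l2 I' c2 I (he ▸ f1 I c1)
    · intro he
      refine l3 I c1 I' c2 ?_ he
      have hcJ := card_image_of_cross hF hJ
      rw [polyad_eq_cliq hv (by omega) hc c1 (mem_cliq.1 hI).2
          (image_eq_of_mem_cliq hF hI hcJ),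
        polyad_eq_cliq hv (by omega) hc c2 (mem_cliq.1 hI').2
          (image_eq_of_mem_cliq hF hI' hcJ)]

end LabFam

end

end HypReg

namespace HypReg

open Finset

attribute [local instance 10] Classical.propDecidable

noncomputable section

namespace LabFam

variable {V : Type*} [DecidableEq V] {F : LabFam V}

theorem cliq_addrOf_eq (hF : F.Coherent) {j i : ℕ} {x : Addr} {I : Finset V}
    (hI : I ∈ F.cliq j i x) (hx : x.1.card = i) (j' i' : ℕ) (hj : j' ≤ j) :
    F.cliq j' i' (F.addrOf j' I) = F.cliq j' i' x := by
  have him := image_eq_of_mem_cliq hF hI hx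
  have hI' := mem_cliq.1 hI
  exact cliq_congr hF him fun M hM h2 hMj =>
    addrOf_snd_of_fits ((mem_cross hF).1 hI'.1).2.2 hI'.2 hM h2 (hMj.trans hj) hMj

theorem mem_cliq_addrOf (hF : F.Coherent) {i : ℕ} {I : Finset V}
    (hI : I ∈ F.toPartFam.cross i) (j : ℕ) : I ∈ F.cliq j i (F.addrOf j I) :=
  mem_cliq.2 ⟨hI, fits_addrOf ((mem_cross hF).1 hI).2.2 le_rfl⟩

theorem isLabeled_of_canon {k : ℕ} {a : ℕ → ℕ} (hv : F.VertexCanon)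
    (hc : ∀ j, 2 ≤ j → j ≤ k - 1 → F.LevelCanon j) (hka : k ≤ a 1)
    (hidx : ∀ v ∈ F.gnd, 1 ≤ F.vIdx v ∧ F.vIdx v ≤ a 1)
    (hlbl : ∀ j, 2 ≤ j → j ≤ k - 1 → ∀ I ∈ F.toPartFam.cross j, 1 ≤ F.lbl j I ∧ F.lbl j I ≤ a j)
    (hex1 : ∀ b ∈ Icc 1 (a 1), ∃ v ∈ F.gnd, F.vIdx v = b)
    (hex : ∀ j, 2 ≤ j → j ≤ k - 1 → ∀ J ∈ F.toPartFam.cross j, ∀ b ∈ Icc 1 (a j),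
      ∃ I ∈ F.cliq (j-1) j (F.addrOf (j-1) J), F.lbl j I = b) :
    F.IsLabeled k a := by
  have hF := hv.coherent
  have hpoly : ∀ j, 2 ≤ j → j ≤ k - 1 → ∀ J ∈ F.toPartFam.cross j,
      F.toPartFam.polyCliques j J = F.cliq (j-1) j (F.addrOf (j-1) J) := fun j hj hjk J hJ =>
    polyCliques_eq_cliq hv hj (fun h2 => hc _ h2 (by omega)) hJ
  have hcls : ∀ j, 2 ≤ j → j ≤ k - 1 → ∀ J ∈ F.toPartFam.cross j, ∀ I ∈ F.cls j J,
      F.cls j I = F.cls j J := by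
    intro j hj hjk J hJ I hI
    rw [hc j hj hjk J hJ] at hI ⊢
    rw [hc j hj hjk I (mem_cliq.1 hI).1]
    exact cliq_addrOf_eq hF hI (card_image_of_cross hF hJ) j j le_rfl
  have hiff : ∀ j, 2 ≤ j → j ≤ k - 1 → ∀ J ∈ F.toPartFam.cross j, ∀ I,
      I ∈ F.cls j J ↔ I ∈ F.cliq (j-1) j (F.addrOf (j-1) J) ∧ F.lbl j I = F.lbl j J := by
    intro j hj hjk J hJ I
    rw [hc j hj hjk J hJ, cliq_succ_addrOf hF hj hJ]
  refine ⟨⟨?_, ?_, ?_, ?_, hka, ?_⟩, hidx, hF, ?_⟩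
  · intro v hv'
    rw [hv v hv']
    simp [hv']
  · intro v hv'
    rw [hv v hv']
    exact filter_subset _ _
  · intro u hu v hv' h
    rw [hv v hv', mem_filter] at h
    exact (hF u hu v hv').1 h.2
  · rw [card_image_eq_of_fibres F.gnd F.vClass F.vIdx
      fun u hu v hv' => (hF u hu v hv').symm]
    have : F.gnd.image F.vIdx = Icc 1 (a 1) := by
      ext b
      rw [mem_image]
      constructor
      · rintro ⟨v, hv', rfl⟩
        exact mem_Icc.2 (hidx v hv')
      · exact hex1 b
    rw [this]
    simp
  · intro j hj hjk
    refine ⟨?_, hcls j hj hjk, ?_, ?_, ?_⟩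
    · intro J hJ
      exact (hiff j hj hjk J hJ J).2 ⟨mem_cliq_addrOf hF hJ _, rfl⟩
    · intro J hJ I hI
      rw [hpoly j hj hjk J hJ]
      exact ((hiff j hj hjk J hJ I).1 hI).1
    · intro J hJ I hI
      rw [hpoly j hj hjk J hJ] at hI
      exact (mem_cliq.1 hI).1
    · intro J hJ
      rw [hpoly j hj hjk J hJ, card_image_eq_of_fibres _ _ (F.lbl j)]
      · have : (F.cliq (j-1) j (F.addrOf (j-1) J)).image (F.lbl j) = Icc 1 (a j) := by
          ext b
          rw [mem_image]
          constructor
          · rintro ⟨I, hI, rfl⟩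
            exact mem_Icc.2 (hlbl j hj hjk I (mem_cliq.1 hI).1)
          · exact hex j hj hjk J hJ b
        rw [this]
        simp
      · intro I hI I' hI'
        have c1 := (mem_cliq.1 hI).1
        have c2 := (mem_cliq.1 hI').1
        constructor
        · intro he
          have : I ∈ F.cls j I := (hiff j hj hjk I c1 I).2 ⟨mem_cliq_addrOf hF c1 _, rfl⟩
          rw [he] at this
          exact ((hiff j hj hjk I' c2 I).1 this).2
        · intro he
          refine hcls j hj hjk I' c2 I ((hiff j hj hjk I' c2 I).2 ⟨?_, he⟩)
          rw [cliq_addrOf_eq hF hI' (card_image_of_cross hF hJ) _ _ le_rfl]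
          exact hI
  · intro j hj hjk
    refine ⟨hlbl j hj hjk, fun I hI I' hI' => ((hiff j hj hjk I hI I').1 hI').2, ?_⟩
    intro I hI I' hI' hp hl
    have : F.toPartFam.polyCliques j I = F.toPartFam.polyCliques j I' := by
      rw [PartFam.polyCliques, PartFam.polyCliques, hp]
    rw [hpoly j hj hjk I hI, hpoly j hj hjk I' hI'] at this
    refine hcls j hj hjk I' hI' I ((hiff j hj hjk I' hI' I).2 ⟨?_, hl⟩)
    rw [← this]
    exact mem_cliq_addrOf hF hI _

/-- Labels and base of `x` lie in the ranges prescribed by `a`. -/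
def Legal (k : ℕ) (a : ℕ → ℕ) (x : Addr) : Prop :=
  x.1 ⊆ Icc 1 (a 1) ∧ ∀ M ⊆ x.1, 2 ≤ M.card → M.card ≤ k - 1 → x.2 M ∈ Icc 1 (a M.card)

theorem Legal.of_isAddress {k : ℕ} {a : ℕ → ℕ} {x : Addr} (h : IsAddress k (k-1) a x) :
    Legal k a x :=
  ⟨fun i hi => mem_Icc.2 (h.2.1 i hi), fun M hM h2 hk => mem_Icc.2 (h.2.2.1 M hM h2 hk)⟩

theorem Legal.base {k : ℕ} {a : ℕ → ℕ} {x : Addr} (h : Legal k a x) {B : Finset ℕ}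
    (hB : B ⊆ x.1) : Legal k a (B, x.2) :=
  ⟨hB.trans h.1, fun M hM => h.2 M (hM.trans hB)⟩

theorem Legal.extend {k : ℕ} {a : ℕ → ℕ} {x : Addr} (h : Legal k a x) (hx : x.1.card ≤ k)
    (hka : k ≤ a 1) (ha : ∀ j, 1 ≤ j → j ≤ k - 1 → 1 ≤ a j) :
    ∃ z : Addr, Legal k a z ∧ z.1.card = k ∧ x.1 ⊆ z.1 ∧ ∀ M ⊆ x.1, z.2 M = x.2 M := by
  obtain ⟨B, h1, h2, h3⟩ := exists_subsuperset_card_eq h.1 hx (by simpa using hka)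
  refine ⟨(B, fun M => if M ⊆ x.1 then x.2 M else 1), ⟨h2, ?_⟩, h3, h1, ?_⟩
  · intro M hM hM2 hMk
    dsimp only
    split_ifs with hMx
    · exact h.2 M hMx hM2 hMk
    · exact mem_Icc.2 ⟨le_rfl, ha _ (by omega) hMk⟩
  · intro M hM
    exact if_pos hM

theorem Legal.addrOf (hF : F.Coherent) {k : ℕ} {a : ℕ → ℕ}
    (hidx : ∀ v ∈ F.gnd, 1 ≤ F.vIdx v ∧ F.vIdx v ≤ a 1)
    (hlbl : ∀ j, 2 ≤ j → j ≤ k - 1 → ∀ I ∈ F.toPartFam.cross j, 1 ≤ F.lbl j I ∧ F.lbl j I ≤ a j)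
    {j : ℕ} {S : Finset V} (hS : S ∈ F.toPartFam.cross j) : Legal k a (F.addrOf (k-1) S) := by
  have hS' := (mem_cross hF).1 hS
  constructor
  · intro b hb
    obtain ⟨v, hv, rfl⟩ := mem_image.1 hb
    exact mem_Icc.2 (hidx v (hS'.1 hv))
  · intro M hM h2 hk
    rw [addrOf_snd hM h2 hk]
    have hc := card_slice hS'.2.2 hM
    have := cross_subset hF hS (slice_subset (F := F) S M)
    rw [hc] at this
    exact mem_Icc.2 (hlbl _ h2 hk _ this)

theorem IsLabeled.exists_superset {k : ℕ} {a : ℕ → ℕ} (h : F.IsLabeled k a) {j : ℕ}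
    (hk : 1 ≤ k) (hjk : j ≤ k) {J : Finset V} (hJ : J ∈ F.toPartFam.cross j) :
    ∃ K ∈ F.toPartFam.cross k, J ⊆ K := by
  have hF := h.vertexCanon.coherent
  have hka : k ≤ a 1 := h.1.2.2.2.2.1
  have hidx := h.2.1
  have hJ' := (mem_cross hF).1 hJ
  obtain ⟨B, h1, h2, h3⟩ := exists_subsuperset_card_eq (s := J.image F.vIdx) (t := Icc 1 (a 1))
    (n := k) (by
      intro b hb
      obtain ⟨v, hv, rfl⟩ := mem_image.1 hb
      exact mem_Icc.2 (hidx v (hJ'.1 hv)))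
    (by rw [card_image_of_cross hF hJ]; exact hjk) (by simpa using hka)
  have hpick : ∀ b ∈ B, ∃ v ∈ F.gnd, F.vIdx v = b := fun b hb => h.exists_vIdx (h2 hb)
  have : Nonempty V := ⟨(h.exists_vIdx (mem_Icc.2 ⟨le_rfl, hk.trans hka⟩)).choose⟩
  choose! g hg1 hg2 using hpick
  have hinj : Set.InjOn F.vIdx (J ∪ (B \ J.image F.vIdx).image g : Finset V) := by
    intro u hu v hv huv
    simp only [coe_union, coe_image, Set.mem_union, mem_coe, Set.mem_image, mem_sdiff] at hu hv
    rcases hu with hu | ⟨b, ⟨hb, hbJ⟩, rfl⟩ <;> rcases hv with hv | ⟨c, ⟨hc, hcJ⟩, rfl⟩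
    · exact hJ'.2.2 hu hv huv
    · rw [hg2 c hc] at huv
      exact absurd (mem_image.2 ⟨u, hu, huv⟩) hcJ
    · rw [hg2 b hb] at huv
      exact absurd (mem_image.2 ⟨v, hv, huv.symm⟩) hbJ
    · rw [hg2 b hb, hg2 c hc] at huv
      rw [huv]
  refine ⟨J ∪ (B \ J.image F.vIdx).image g, ?_, subset_union_left⟩
  rw [mem_cross hF]
  refine ⟨union_subset hJ'.1 ?_, ?_, hinj⟩
  · intro v hv
    obtain ⟨b, hb, rfl⟩ := mem_image.1 hv
    exact hg1 b (mem_sdiff.1 hb).1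
  · rw [← card_image_of_injOn hinj, ← h3]
    congr 1
    ext b
    simp only [mem_image, mem_union, mem_sdiff]
    constructor
    · rintro ⟨v, hv | ⟨c, ⟨hc, -⟩, rfl⟩, rfl⟩
      · exact h1 (mem_image_of_mem _ hv)
      · rw [hg2 c hc]; exact hc
    · intro hb
      by_cases hbJ : ∃ v ∈ J, F.vIdx v = b
      · obtain ⟨v, hv, rfl⟩ := hbJ
        exact ⟨v, Or.inl hv, rfl⟩
      · exact ⟨g b, Or.inr ⟨b, ⟨hb, hbJ⟩, rfl⟩, hg2 b hb⟩

theorem KsetC_mono {W : Finset V} {cr : Finset (Finset V)} {j i : ℕ} {A B : Finset (Finset V)}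
    (h : A ⊆ B) : KsetC W cr j i A ⊆ KsetC W cr j i B := by
  unfold KsetC Kset
  split_ifs
  · exact monotone_filter_right _ fun S _ hS v hv => h (hS v hv)
  · exact monotone_filter_right _ fun S _ hS T hT => h (hS T hT)

/-- Polyads realised by crossing sets are regular. -/
theorem IsLabeled.regPairC {k : ℕ} {a : ℕ → ℕ} (h : F.IsLabeled k a) {ε : ℝ}
    (hreg : F.toPartFam.PolyadReg k a ε) {x : Addr} (hx : Legal k a x) {i : ℕ}
    (hi : 2 ≤ i) (hik : i ≤ k - 1) (hne : (F.cliq (i-1) x.1.card x).Nonempty)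
    {B : Finset ℕ} (hB : B ⊆ x.1) (hBc : B.card = i) :
    RegPairC F.gnd (F.toPartFam.cross i) (i-1) ε (1 / (a i : ℝ)) (F.cliq i i x)
      (F.cliq (i-1) (i-1) (B, x.2)) := by
  have hv := h.vertexCanon
  have hF := hv.coherent
  obtain ⟨K, hK⟩ := hne
  have hKim := image_eq_of_mem_cliq hF hK rfl
  have hJ := slice_mem_cliq hF hK (hKim ▸ hB) (le_refl (i-1))
  rw [hBc] at hJ
  obtain ⟨I, hI, hIl⟩ := h.exists_lbl hi hik (mem_cliq.1 hJ).1 (b := x.2 B)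
    (by have := hx.2 B hB (by omega) (by omega); rwa [hBc] at this)
  rw [cliq_addrOf_eq hF hJ hBc _ _ le_rfl] at hI
  have hIc := mem_cliq.1 hI
  have hIim := image_eq_of_mem_cliq hF hI hBc
  obtain ⟨K', hK', hIK'⟩ := h.exists_superset (by omega) (show i ≤ k by omega) hIc.1
  have hKc := (mem_cross hF).1 hK'
  have hcan : ∀ j, 2 ≤ j → j ≤ k - 1 → F.LevelCanon j := fun j => h.levelCanon j
  have key := hreg K' hK' i hi hik I
    (mem_powersetCard.2 ⟨hIK', ((mem_cross hF).1 hIc.1).2.1⟩)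
  rw [polyad_eq_cliq hv (by omega) (fun h2 => hcan (i-1) h2 (by omega)) hIc.1 hIc.2 hIim,
    polyad_eq_cliq hv (by omega) (fun h2 => hcan i h2 hik) hK'
      (fits_addrOf hKc.2.2 le_rfl) rfl] at key
  intro Q hQ hQK
  have := key Q hQ hQK
  have hK1 : KsetC F.gnd (F.toPartFam.cross i) (i-1) i (F.cliq (i-1) (i-1) (B, x.2)) =
      F.cliq (i-1) i (B, x.2) := by
    obtain ⟨i', rfl⟩ : ∃ i', i = i' + 1 := ⟨i - 1, by omega⟩
    exact KsetC_cliq hF (by omega) le_rfl _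
  have heq : F.cliq i i (F.addrOf i K') ∩ KsetC F.gnd (F.toPartFam.cross i) (i-1) (i-1+1) Q =
      F.cliq i i x ∩ KsetC F.gnd (F.toPartFam.cross i) (i-1) (i-1+1) Q := by
    have hsucc : i - 1 + 1 = i := by omega
    rw [hsucc]
    ext S
    rw [mem_inter, mem_inter]
    refine and_congr_left fun hS => ?_
    have hS1 : S ∈ F.cliq (i-1) i (B, x.2) := hK1 ▸ KsetC_mono hQ hS
    have hSim := image_eq_of_mem_cliq hF hS1 hBc
    have hSc := mem_cliq.1 hS1
    have hSi := ((mem_cross hF).1 hSc.1).2.2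
    have hIimK : B ⊆ K'.image F.vIdx := by
      dsimp only at hIim
      rw [← hIim]; exact image_subset_image hIK'
    have hlab : (F.addrOf i K').2 B = x.2 B := by
      rw [addrOf_snd hIimK (by omega) (by omega), hBc, ← hIl]
      have : F.slice K' B = I := by
        dsimp only at hIim
        rw [← hIim]; exact slice_image hKc.2.2 hIK'
      rw [this]
    dsimp only at hSim hIim
    rw [mem_cliq, mem_cliq]
    refine and_congr_right fun _ => ?_
    rw [fits_succ hF hi hSc.1, fits_succ hF hi hSc.1, hSim, hlab]
    refine and_congr_left fun _ => ⟨fun _ => ?_, fun _ => ?_⟩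
    · exact hSc.2.congr hSi (hSim ▸ hB) fun _ _ _ _ => rfl
    · refine hSc.2.congr hSi (hSim ▸ hIimK) fun M hM h2 hMi => ?_
      rw [hSim, ← hIim] at hM
      have e1 := addrOf_snd_of_fits ((mem_cross hF).1 hIc.1).2.2 hIc.2 hM h2 hMi hMi
      rw [addrOf_snd (hM.trans (image_subset_image hIK')) h2 (by omega)]
      rw [← e1, addrOf_snd hM h2 hMi]
      congr 1
      rw [← slice_image hKc.2.2 ((slice_subset (F := F) I M).trans hIK'), image_slice hM]
  rwa [heq] at this

end LabFam

end

end HypReg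

namespace HypReg

open Finset

attribute [local instance 10] Classical.propDecidable

noncomputable section

namespace LabFam

variable {V : Type*} [DecidableEq V] {F : LabFam V}

/-- The complex of crossing sets whose labels up to level `j` are prescribed by `x`;
above level `j` all cliques are kept. -/
def complexAt (F : LabFam V) (j : ℕ) (x : Addr) {l : ℕ} (hx : x.1.card = l) : Cx V l where
  C t := F.gnd.filter fun v => F.vIdx v = x.1.orderEmbOfFin hx t
  G i := F.cliq (min i j) i x

section

variable {j l : ℕ} {x : Addr} {hx : x.1.card = l}

theorem complexAt_sup (L : Finset (Fin l)) {v : V} :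
    v ∈ L.sup (F.complexAt j x hx).C ↔
      v ∈ F.gnd ∧ F.vIdx v ∈ L.image (x.1.orderEmbOfFin hx) := by
  simp only [complexAt, mem_sup, mem_filter, mem_image]
  constructor
  · rintro ⟨t, ht, hv, he⟩
    exact ⟨hv, t, ht, he.symm⟩
  · rintro ⟨hv, t, ht, he⟩
    exact ⟨t, ht, hv, he.symm⟩

theorem image_orderEmb_subset (L : Finset (Fin l)) : L.image (x.1.orderEmbOfFin hx) ⊆ x.1 := by
  intro b hb
  obtain ⟨t, -, rfl⟩ := mem_image.1 hb
  exact orderEmbOfFin_mem _ _ _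

theorem mem_complexAt_gnd {v : V} :
    v ∈ (F.complexAt j x hx).gnd ↔ v ∈ F.gnd ∧ F.vIdx v ∈ x.1 := by
  rw [Cx.gnd, complexAt_sup]
  simp

theorem complexAt_cross (hF : F.Coherent) (i : ℕ) :
    (F.complexAt j x hx).cross i = F.cliq 1 i x := by
  ext S
  rw [Cx.cross, mem_filter, mem_powersetCard, mem_cliq, mem_cross hF]
  constructor
  · rintro ⟨⟨hS, hc⟩, h⟩
    have hS' : ∀ v ∈ S, v ∈ F.gnd ∧ F.vIdx v ∈ x.1 := fun v hv => mem_complexAt_gnd.1 (hS hv)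
    refine ⟨⟨fun v hv => (hS' v hv).1, hc, ?_⟩, fun v hv => (hS' v hv).2,
      fun T _ h2 h1 => by omega⟩
    intro u hu v hv huv
    have hr := (range_orderEmbOfFin x.1 hx).superset (mem_coe.2 (hS' u hu).2)
    obtain ⟨t, ht⟩ := hr
    refine card_le_one.1 (h t) u ?_ v ?_
    · simp only [complexAt, mem_inter, mem_filter]
      exact ⟨hu, (hS' u hu).1, ht.symm⟩
    · simp only [complexAt, mem_inter, mem_filter]
      exact ⟨hv, (hS' v hv).1, huv ▸ ht.symm⟩
  · rintro ⟨⟨hS, hc, hi⟩, hf⟩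
    refine ⟨⟨fun v hv => mem_complexAt_gnd.2 ⟨hS hv, hf.1 v hv⟩, hc⟩, fun t => ?_⟩
    refine card_le_one.2 fun u hu v hv => ?_
    simp only [complexAt, mem_inter, mem_filter] at hu hv
    exact hi hu.1 hv.1 (hu.2.2.trans hv.2.2.symm)

theorem complexAt_restr (hF : F.Coherent) {i : ℕ} (hi : 1 ≤ i)
    (L : Finset (Fin l)) :
    (F.complexAt j x hx).restr i L =
      F.cliq (min i j) i (L.image (x.1.orderEmbOfFin hx), x.2) := by
  rcases Nat.eq_or_lt_of_le hi with rfl | hi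
  · rw [Cx.restr, if_pos rfl, cliq_one hF]
    congr 1
    ext v
    rw [complexAt_sup, mem_filter]
  · rw [Cx.restr, if_neg (by omega)]
    ext S
    rw [mem_filter, complexAt, mem_cliq, mem_cliq, and_assoc]
    refine and_congr_right fun hS => ?_
    have hS' := (mem_cross hF).1 hS
    have hsub : S ⊆ L.sup (F.complexAt j x hx).C ↔
        S.image F.vIdx ⊆ L.image (x.1.orderEmbOfFin hx) := by
      constructor
      · intro h b hb
        obtain ⟨v, hv, rfl⟩ := mem_image.1 hb
        exact (complexAt_sup L).1 (h hv) |>.2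
      · intro h v hv
        exact (complexAt_sup L).2 ⟨hS'.1 hv, h (mem_image_of_mem _ hv)⟩
    constructor
    · rintro ⟨hf, h⟩
      exact hf.congr hS'.2.2 (hsub.1 h) fun _ _ _ _ => rfl
    · intro hf
      exact ⟨hf.congr hS'.2.2 (hf.image_subset.trans (image_orderEmb_subset L))
        fun _ _ _ _ => rfl, hsub.2 hf.image_subset⟩

theorem KsetC_complexAt (hF : F.Coherent) {j' i : ℕ} (hi : 1 ≤ i) {y : Addr} (hy : y.1 ⊆ x.1)
    {Q : Finset (Finset V)} (hQ : Q ⊆ F.cliq j' i y) :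
    KsetC (F.complexAt j x hx).gnd ((F.complexAt j x hx).cross (i+1)) i (i+1) Q =
      KsetC F.gnd (F.toPartFam.cross (i+1)) i (i+1) Q := by
  have hQ' : ∀ T ∈ Q, ∀ v ∈ T, F.vIdx v ∈ x.1 := fun T hT v hv =>
    hy ((mem_cliq.1 (hQ hT)).2.1 v hv)
  ext S
  rcases Nat.eq_or_lt_of_le hi with rfl | hi
  · rw [KsetC, KsetC, if_pos rfl, if_pos rfl, mem_filter, mem_filter, complexAt_cross hF,
      mem_cliq]
    refine and_congr_left fun h => ⟨fun hS => hS.1, fun hS => ⟨hS, fun v hv => ?_,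
      fun T _ h2 h1 => by omega⟩⟩
    exact hQ' _ (h v hv) v (mem_singleton_self v)
  · rw [KsetC, KsetC, if_neg (by omega), if_neg (by omega), Kset, Kset, mem_filter, mem_filter,
      mem_powersetCard, mem_powersetCard]
    refine and_congr_left fun h => and_congr_left fun hc => ⟨fun hS v hv => ?_, fun hS v hv => ?_⟩
    · exact (mem_complexAt_gnd.1 (hS hv)).1
    · refine mem_complexAt_gnd.2 ⟨hS hv, ?_⟩
      obtain ⟨T, hvT, hTS, hTc⟩ := exists_subsuperset_card_eq (s := {v}) (t := S) (n := i)
        (by simpa using hv) (by simp; omega) (by omega)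
      exact hQ' T (h T (mem_powersetCard.2 ⟨hTS, hTc⟩)) v (hvT (mem_singleton_self v))

theorem complexAt_isComplex (hF : F.Coherent) (hj : 1 ≤ j) (k : ℕ) :
    (F.complexAt j x hx).IsComplex k := by
  refine ⟨?_, ?_, ?_⟩
  · intro s t hst
    rw [disjoint_left]
    intro v hv hv'
    simp only [complexAt, mem_filter] at hv hv'
    exact hst ((x.1.orderEmbOfFin hx).injective (hv.2.symm.trans hv'.2))
  · intro i hi _
    rw [complexAt_cross hF]
    exact cliq_mono x (by omega)
  · intro i hi _ S hS
    have hS' := (mem_cross hF).1 (mem_cliq.1 hS).1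
    rw [Kset, mem_filter, mem_powersetCard]
    refine ⟨⟨fun v hv => mem_complexAt_gnd.2 ⟨hS'.1 hv, (mem_cliq.1 hS).2.1 v hv⟩, hS'.2.1⟩,
      fun T hT => ?_⟩
    rw [mem_powersetCard] at hT
    have := mem_cliq_of_subset hF (j' := min (i-1) j) hS hT.1 (by omega)
    rwa [hT.2] at this

theorem complexAt_isRegular (hF : F.Coherent) (hj : 1 ≤ j) {k : ℕ} {ε : ℝ} (hε : 0 ≤ ε)
    {a : ℕ → ℕ}
    (hreg : ∀ i, 2 ≤ i → i ≤ j → ∀ B ⊆ x.1, B.card = i →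
      RegPairC F.gnd (F.toPartFam.cross i) (i-1) ε (1 / (a i : ℝ)) (F.cliq i i x)
        (F.cliq (i-1) (i-1) (B, x.2))) :
    (F.complexAt j x hx).IsRegular k ε fun i => if i ≤ j then 1 / (a i : ℝ) else 1 := by
  intro i hi _ L hL
  rw [mem_powersetCard] at hL
  obtain ⟨i, rfl⟩ : ∃ i', i = i' + 1 := ⟨i - 1, by omega⟩
  have hB := image_orderEmb_subset (hx := hx) L
  have hBc : (L.image (x.1.orderEmbOfFin hx)).card = i + 1 := by
    rw [card_image_of_injective _ (x.1.orderEmbOfFin hx).injective, hL.2]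
  rw [complexAt_restr hF (by omega), Nat.add_sub_cancel]
  intro Q hQ hQK
  rw [KsetC_complexAt hF (by omega) hB hQ] at hQK ⊢
  rw [KsetC_complexAt hF (by omega) hB subset_rfl] at hQK
  beta_reduce
  split_ifs with hij
  · have hr := hreg (i+1) hi hij _ hB hBc
    rw [Nat.add_sub_cancel] at hr
    have e1 : min i j = i := by omega
    have e2 : (F.complexAt j x hx).G (i+1) = F.cliq (i+1) (i+1) x := by
      simp only [complexAt]
      rw [min_eq_left hij]
    rw [e1] at hQ hQK
    rw [e2]
    exact hr Q hQ hQK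
  · have e1 : min i j = j := by omega
    have e2 : (F.complexAt j x hx).G (i+1) = F.cliq j (i+1) x := by
      simp only [complexAt]
      rw [min_eq_right (by omega)]
    rw [e1] at hQ
    rw [e2]
    have hsub : KsetC F.gnd (F.toPartFam.cross (i+1)) i (i+1) Q ⊆ F.cliq j (i+1) x := by
      refine (KsetC_mono hQ).trans ?_
      rw [KsetC_cliq hF hj (by omega)]
      intro S hS
      rw [mem_cliq] at hS ⊢
      exact ⟨hS.1, hS.2.congr ((mem_cross hF).1 hS.1).2.2 (hS.2.image_subset.trans hB)
        fun _ _ _ _ => rfl⟩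
    rw [inter_eq_right.2 hsub, one_mul, sub_self, abs_zero]
    positivity

theorem complexAt_Kset (hF : F.Coherent) (hj : 1 ≤ j) {i : ℕ} (hi : 2 ≤ i) (hji : j ≤ i) :
    Kset (F.complexAt j x hx).gnd i (i+1) ((F.complexAt j x hx).G i) = F.cliq j (i+1) x := by
  have h := KsetC_complexAt (j := j) (hx := hx) hF (show 1 ≤ i by omega) (subset_refl x.1)
    (subset_refl (F.cliq j i x))
  rw [KsetC_cliq hF hj hji, KsetC, if_neg (by omega)] at h
  rw [← h]
  simp only [complexAt]
  rw [min_eq_right hji]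

end

/-- The number of crossing `k`-sets on prescribed classes. -/
theorem pow_le_card_cliq_one (hF : F.Coherent) {x : Addr} {k m : ℕ} (hx : x.1.card = k)
    (hm : ∀ b ∈ x.1, m ≤ (F.gnd.filter fun v => F.vIdx v = b).card) :
    m ^ k ≤ (F.cliq 1 k x).card := by
  set e := x.1.orderEmbOfFin hx with he
  let C : Fin k → Finset V := fun t => F.gnd.filter fun v => F.vIdx v = e t
  have hcard : m ^ k ≤ (Fintype.piFinset C).card := by
    rw [Fintype.card_piFinset]
    calc m ^ k = ∏ _t : Fin k, m := by simp
      _ ≤ ∏ t, (C t).card := prod_le_prod' fun t _ => hm _ (orderEmbOfFin_mem _ _ _)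
  have hmem : ∀ f ∈ Fintype.piFinset C, ∀ t, f t ∈ F.gnd ∧ F.vIdx (f t) = e t := by
    intro f hf t
    exact mem_filter.1 (Fintype.mem_piFinset.1 hf t)
  refine hcard.trans (card_le_card_of_injOn (fun f => univ.image f) ?_ ?_)
  · intro f hf
    have hf' := hmem f hf
    have hinj : Function.Injective f := fun s t hst => e.injective (by
      rw [← (hf' s).2, ← (hf' t).2, hst])
    refine mem_cliq.2 ⟨(mem_cross hF).2 ⟨?_, ?_, ?_⟩, ?_, fun T _ h2 h1 => by omega⟩
    · intro v hv
      obtain ⟨t, -, rfl⟩ := mem_image.1 hv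
      exact (hf' t).1
    · rw [card_image_of_injective _ hinj]; simp
    · intro u hu v hv huv
      obtain ⟨s, -, rfl⟩ := mem_image.1 (mem_coe.1 hu)
      obtain ⟨t, -, rfl⟩ := mem_image.1 (mem_coe.1 hv)
      rw [(hf' s).2, (hf' t).2] at huv
      rw [e.injective huv]
    · intro v hv
      obtain ⟨t, -, rfl⟩ := mem_image.1 hv
      rw [(hf' t).2]
      exact orderEmbOfFin_mem _ _ _
  · intro f hf g hg hfg
    have hf' := hmem f hf
    have hg' := hmem g hg
    funext t
    have : f t ∈ univ.image g := by
      have h2 : univ.image f = univ.image g := hfg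
      rw [← h2]
      exact mem_image_of_mem _ (mem_univ t)
    obtain ⟨s, -, hs⟩ := mem_image.1 this
    have hst : e s = e t := by rw [← (hg' s).2, hs, (hf' t).2]
    rw [← hs, e.injective hst]

theorem pow_le_prod_density {k t : ℕ} (ht : 1 ≤ t) {d : ℕ → ℝ}
    (hd : ∀ i ∈ Icc 2 (k-1), 1 / (t : ℝ) ≤ d i) :
    (1 / (t : ℝ)) ^ (2 ^ k) ≤ ∏ i ∈ Icc 2 (k-1), d i ^ (k.choose i) := by
  have ht0 : (0 : ℝ) < t := by exact_mod_cast ht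
  have ht1 : 1 / (t : ℝ) ≤ 1 := by
    rw [div_le_one ht0]; exact_mod_cast ht
  calc (1 / (t : ℝ)) ^ (2 ^ k) ≤ (1 / (t : ℝ)) ^ (∑ i ∈ Icc 2 (k-1), k.choose i) := by
        refine pow_le_pow_of_le_one (by positivity) ht1 ?_
        rw [← Nat.sum_range_choose]
        refine sum_le_sum_of_subset fun i hi => ?_
        rw [mem_Icc] at hi
        rw [mem_range]
        omega
    _ = ∏ i ∈ Icc 2 (k-1), (1 / (t : ℝ)) ^ (k.choose i) := (prod_pow_eq_pow_sum _ _ _).symm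
    _ ≤ _ := prod_le_prod (fun i _ => by positivity) fun i hi => by
        have := hd i hi
        gcongr

end LabFam

namespace LabFam

variable {V : Type} [DecidableEq V] {F : LabFam V}

theorem le_card_cliq_of_counting {eCL : ℝ → ℝ → ℕ → ℕ → ℝ} {mCL : ℝ → ℝ → ℕ → ℕ → ℕ}
    (hCL : CountingProp eCL mCL) (hF : F.Coherent) {k j t m : ℕ} {ε : ℝ} {a : ℕ → ℕ} {x : Addr}
    (hk : 3 ≤ k) (hj : 1 ≤ j) (hjk : j ≤ k - 1) (ht : 2 ≤ t) (hx : x.1.card = k)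
    (hε : 0 < ε) (hεt : ε ≤ eCL (1 / (t : ℝ)) (1 / (t : ℝ)) (k-1) k)
    (ha : ∀ i, 2 ≤ i → i ≤ k - 1 → 1 ≤ a i ∧ a i ≤ t)
    (hm5 : 5 ≤ m) (hmt : mCL (1 / (t : ℝ)) (1 / (t : ℝ)) (k-1) k ≤ m)
    (hm : ∀ b ∈ x.1, (F.gnd.filter fun v => F.vIdx v = b).card = m ∨
      (F.gnd.filter fun v => F.vIdx v = b).card = m + 1)
    (hreg : ∀ i, 2 ≤ i → i ≤ j → ∀ B ⊆ x.1, B.card = i →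
      RegPairC F.gnd (F.toPartFam.cross i) (i-1) ε (1 / (a i : ℝ)) (F.cliq i i x)
        (F.cliq (i-1) (i-1) (B, x.2))) :
    1 / 2 * ((1 / (t : ℝ)) ^ (2 ^ k) * (m : ℝ) ^ k) ≤ ((F.cliq j k x).card : ℝ) := by
  have ht0 : (0 : ℝ) < t := by exact_mod_cast (by omega : 0 < t)
  have ht2 : 1 / (t : ℝ) ≤ 1 / 2 := by
    apply one_div_le_one_div_of_le (by norm_num); exact_mod_cast ht
  set d : ℕ → ℝ := fun i => if i ≤ j then 1 / (a i : ℝ) else 1 with hd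
  have hdt : ∀ i, 2 ≤ i → i ≤ k - 1 → 1 / (t : ℝ) ≤ d i := by
    intro i hi hik
    simp only [hd]
    split_ifs
    · apply one_div_le_one_div_of_le
      · exact_mod_cast (ha i hi hik).1
      · exact_mod_cast (ha i hi hik).2
    · linarith
  have hcount := (hCL (1 / t) (1 / t) (by positivity) (by positivity) (k-1) k (by omega)
    (by omega)).2 V (F.complexAt j x hx) m (1/5) ε d (by norm_num) (by norm_num) hε hεt hmt hdt
    (complexAt_isComplex hF hj _) ?_ (complexAt_isRegular hF hj hε.le hreg)
  · have hK : Kset (F.complexAt j x hx).gnd (k-1) k ((F.complexAt j x hx).G (k-1)) =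
        F.cliq j k x := by
      obtain ⟨i, rfl⟩ : ∃ i, k = i + 1 := ⟨k - 1, by omega⟩
      exact complexAt_Kset hF hj (by omega) hjk
    rw [hK] at hcount
    have hprod := pow_le_prod_density (k := k) (by omega : 1 ≤ t) (d := d)
      (fun i hi => hdt i (mem_Icc.1 hi).1 (mem_Icc.1 hi).2)
    have hclass : (m : ℝ) ^ k ≤ ∏ i, (((F.complexAt j x hx).C i).card : ℝ) := by
      calc (m : ℝ) ^ k = ∏ _i : Fin k, (m : ℝ) := by simp
        _ ≤ _ := prod_le_prod (fun _ _ => by positivity) fun i _ => by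
          have := hm _ (orderEmbOfFin_mem x.1 hx i)
          have h2 : m ≤ ((F.complexAt j x hx).C i).card := by
            simp only [complexAt]; omega
          exact_mod_cast h2
    have hmul : (1 / (t : ℝ)) ^ (2 ^ k) * (m : ℝ) ^ k ≤
        (∏ i ∈ Icc 2 (k-1), d i ^ (k.choose i)) *
          ∏ i, (((F.complexAt j x hx).C i).card : ℝ) :=
      mul_le_mul hprod hclass (by positivity) (le_trans (by positivity) hprod)
    have hpos : (0 : ℝ) ≤ (1 / (t : ℝ)) ^ (2 ^ k) * (m : ℝ) ^ k := by positivity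
    have := (abs_le.1 hcount).1
    nlinarith
  · intro i
    have := hm _ (orderEmbOfFin_mem x.1 hx i)
    have h5 : (5 : ℝ) ≤ m := by exact_mod_cast hm5
    have h2 : ((F.complexAt j x hx).C i).card = m ∨
        ((F.complexAt j x hx).C i).card = m + 1 := by
      simpa only [complexAt] using this
    rcases h2 with h | h <;> rw [h]
    · simp
    · push_cast
      rw [add_sub_cancel_left, abs_one]
      linarith

/-- Every legal address is realised by a positive proportion of the crossing `k`-sets. -/
theorem IsLabeled.le_card_cliq {eCL : ℝ → ℝ → ℕ → ℕ → ℝ} {mCL : ℝ → ℝ → ℕ → ℕ → ℕ}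
    (hCL : CountingProp eCL mCL) {k t m : ℕ} {ε : ℝ} {a : ℕ → ℕ} {x : Addr}
    (h : F.IsLabeled k a) (hpr : F.toPartFam.PolyadReg k a ε) (hl : Legal k a x)
    (hk : 2 ≤ k) (ht : 2 ≤ t) (hx : x.1.card = k)
    (hε : 0 < ε) (hεt : 3 ≤ k → ε ≤ eCL (1 / (t : ℝ)) (1 / (t : ℝ)) (k-1) k)
    (ha : ∀ i, 2 ≤ i → i ≤ k - 1 → 1 ≤ a i ∧ a i ≤ t)
    (hm5 : 5 ≤ m) (hmt : 3 ≤ k → mCL (1 / (t : ℝ)) (1 / (t : ℝ)) (k-1) k ≤ m)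
    (hm : ∀ b ∈ x.1, (F.gnd.filter fun v => F.vIdx v = b).card = m ∨
      (F.gnd.filter fun v => F.vIdx v = b).card = m + 1) {j : ℕ} (hj : 1 ≤ j) :
    j ≤ k - 1 →
    1 / 2 * ((1 / (t : ℝ)) ^ (2 ^ k) * (m : ℝ) ^ k) ≤ ((F.cliq j k x).card : ℝ) := by
  have hF := h.vertexCanon.coherent
  have ht0 : (0 : ℝ) < t := by exact_mod_cast (by omega : 0 < t)
  have hm0 : (0 : ℝ) < m := by exact_mod_cast (by omega : 0 < m)
  induction j, hj using Nat.le_induction with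
  | base =>
    intro _
    have h1 : ((m ^ k : ℕ) : ℝ) ≤ ((F.cliq 1 k x).card : ℝ) := by
      exact_mod_cast pow_le_card_cliq_one hF hx fun b hb => by
        have := hm b hb
        omega
    push_cast at h1
    have ht1 : (1 / (t : ℝ)) ^ (2 ^ k) ≤ 1 := by
      apply pow_le_one₀ (by positivity)
      rw [div_le_one ht0]; exact_mod_cast (by omega : 1 ≤ t)
    have hp : (0 : ℝ) < (m : ℝ) ^ k := by positivity
    nlinarith
  | succ j hj ih =>
    intro hjk
    have hne : (F.cliq j k x).Nonempty := by
      have := ih (by omega)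
      have hp : (0 : ℝ) < 1 / 2 * ((1 / (t : ℝ)) ^ (2 ^ k) * (m : ℝ) ^ k) := by positivity
      have : (0 : ℝ) < ((F.cliq j k x).card : ℝ) := hp.trans_le this
      exact card_pos.1 (by exact_mod_cast this)
    refine le_card_cliq_of_counting hCL hF (by omega) (by omega) hjk ht hx hε (hεt (by omega)) ha
      hm5 (hmt (by omega)) hm fun i hi hij B hB hBc => ?_
    exact h.regPairC hpr hl hi (by omega) (hx ▸ hne.mono (cliq_mono x (by omega))) hB hBc

end LabFam

end

end HypReg

namespace HypReg

open Finset

attribute [local instance 10] Classical.propDecidable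

noncomputable section

namespace LabFam

variable {V : Type*} [DecidableEq V] {F G : LabFam V}

theorem card_cliq_le_mul_pow (hF : F.Coherent) {j j' i k : ℕ} {y z : Addr} (hj : j' ≤ j)
    (hz : z.1.card = k) (hy : y.1.card = i) (hyz : y.1 ⊆ z.1)
    (hlab : ∀ M ⊆ y.1, z.2 M = y.2 M) :
    (F.cliq j k z).card ≤ (F.cliq j' i y).card * F.gnd.card ^ (k - i) := by
  rw [mul_comm]
  refine card_le_mul_card_image_of_maps_to (f := fun K => F.slice K y.1) ?_ _ ?_
  · intro K hK
    have him := image_eq_of_mem_cliq hF hK hz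
    have := slice_mem_cliq hF hK (him ▸ hyz) hj
    rw [hy] at this
    rwa [cliq_congr hF (x := (y.1, z.2)) (y := y) rfl fun M hM _ _ => hlab M hM] at this
  · intro J hJ
    refine (card_le_card_of_injOn (t := F.gnd.powersetCard (k - i)) (fun K => K \ J) ?_ ?_).trans
      ((card_powersetCard _ _).trans_le (Nat.choose_le_pow _ _))
    · intro K hK
      rw [mem_coe, mem_filter] at hK
      have hsub : J ⊆ K := hK.2 ▸ slice_subset (F := F) K y.1
      have hKc := (mem_cross hF).1 (mem_cliq.1 hK.1).1
      have hJc := (mem_cross hF).1 (mem_cliq.1 hJ).1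
      rw [mem_coe, mem_powersetCard, card_sdiff_of_subset hsub, hKc.2.1, hJc.2.1]
      exact ⟨sdiff_subset.trans hKc.1, rfl⟩
    · intro K hK K' hK' hKK
      rw [mem_coe, mem_filter] at hK hK'
      have hsub : J ⊆ K := hK.2 ▸ slice_subset (F := F) K y.1
      have hsub' : J ⊆ K' := hK'.2 ▸ slice_subset (F := F) K' y.1
      dsimp only at hKK
      rw [← sdiff_union_of_subset hsub, ← sdiff_union_of_subset hsub', hKK]

/-- The families `F` and `G` give the same index to all vertices of `S`, and the same label to
all its subsets of size between two and `k - 1`. -/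
def Agree (F G : LabFam V) (k : ℕ) (S : Finset V) : Prop :=
  (∀ v ∈ S, F.vIdx v = G.vIdx v) ∧
  ∀ T ⊆ S, 2 ≤ T.card → T.card ≤ k - 1 → F.lbl T.card T = G.lbl T.card T

section Agree

variable {k : ℕ} {S T : Finset V}

theorem Agree.symm (h : Agree F G k S) : Agree G F k S :=
  ⟨fun v hv => (h.1 v hv).symm, fun T hT h2 hk => (h.2 T hT h2 hk).symm⟩

theorem Agree.mono (h : Agree F G k S) (hT : T ⊆ S) : Agree F G k T :=
  ⟨fun v hv => h.1 v (hT hv), fun U hU h2 hk => h.2 U (hU.trans hT) h2 hk⟩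

theorem Agree.image_eq (h : Agree F G k S) : S.image F.vIdx = S.image G.vIdx :=
  image_congr fun v hv => h.1 v hv

theorem Agree.cross (hF : F.Coherent) (hG : G.Coherent) (hgnd : F.gnd = G.gnd)
    (h : Agree F G k S) {i : ℕ} (hS : S ∈ F.toPartFam.cross i) : S ∈ G.toPartFam.cross i := by
  rw [mem_cross hF] at hS
  rw [mem_cross hG, ← hgnd]
  exact ⟨hS.1, hS.2.1, hS.2.2.congr fun v hv => h.1 v hv⟩

theorem Agree.fits (h : Agree F G k S) {j : ℕ} (hj : j ≤ k - 1) {x : Addr}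
    (hS : F.Fits j x S) : G.Fits j x S := by
  refine ⟨fun v hv => h.1 v hv ▸ hS.1 v hv, fun T hT h2 hTj => ?_⟩
  rw [← h.2 T hT h2 (hTj.trans hj), hS.2 T hT h2 hTj, (h.mono hT).image_eq]

theorem Agree.cliq (hF : F.Coherent) (hG : G.Coherent) (hgnd : F.gnd = G.gnd)
    (h : Agree F G k S) {j i : ℕ} (hj : j ≤ k - 1) {x : Addr} (hS : S ∈ F.cliq j i x) :
    S ∈ G.cliq j i x := by
  rw [mem_cliq] at *
  exact ⟨h.cross hF hG hgnd hS.1, h.fits hj hS.2⟩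

theorem Agree.slice (h : Agree F G k S) (M : Finset ℕ) : F.slice S M = G.slice S M :=
  filter_congr fun v hv => by rw [h.1 v hv]

theorem Agree.addrOf (h : Agree F G k S) (hS : Set.InjOn F.vIdx S) {j : ℕ} (hj : j ≤ k - 1) :
    F.addrOf j S = G.addrOf j S := by
  refine Prod.ext h.image_eq (funext fun M => ?_)
  by_cases hM : M ⊆ S.image F.vIdx ∧ 2 ≤ M.card ∧ M.card ≤ j
  · have hc := card_slice hS hM.1
    have h2 := h.2 (F.slice S M) (slice_subset S M) (by omega) (by omega)
    rw [addrOf_snd hM.1 hM.2.1 hM.2.2, addrOf_snd (h.image_eq ▸ hM.1) hM.2.1 hM.2.2, ← h.slice,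
      ← hc, h2]
  · simp only [LabFam.addrOf]
    rw [if_neg hM, if_neg (h.image_eq ▸ hM)]

theorem Agree.partAt (hF : F.Coherent) (hG : G.Coherent) (hgnd : F.gnd = G.gnd)
    (h : Agree F G k S) {j : ℕ} (hj : j ≤ k - 1) {x : Addr} {b : ℕ} (hS : S ∈ F.partAt j x b) :
    S ∈ G.partAt j x b := by
  rcases Nat.lt_or_ge 1 j with hj1 | hj1
  · rw [LabFam.partAt, if_neg (by omega), mem_filter] at *
    have hS' := (mem_cross hF).1 hS.1
    refine ⟨h.cross hF hG hgnd hS.1, ?_, ?_⟩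
    · rw [← h.addrOf hS'.2.2 (by omega), hS.2.1]
    · have := h.2 S subset_rfl (by omega) (by omega)
      rw [hS'.2.1] at this
      rw [← this, hS.2.2]
  · rw [LabFam.partAt, if_pos hj1] at *
    split_ifs at hS ⊢ with hx
    · obtain ⟨v, hv, rfl⟩ := mem_sing.1 hS
      rw [mem_filter] at hv
      rw [singleton_mem_sing, mem_filter, ← hgnd, ← h.1 v (mem_singleton_self v)]
      exact hv
    · exact absurd hS (notMem_empty _)

theorem partAt_subset_powersetCard {j : ℕ} (hj : 1 ≤ j) (x : Addr) (b : ℕ) :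
    F.partAt j x b ⊆ F.gnd.powersetCard j := by
  intro S hS
  rw [LabFam.partAt] at hS
  split_ifs at hS with h1 hx
  · obtain ⟨v, hv, rfl⟩ := mem_sing.1 hS
    rw [mem_powersetCard]
    exact ⟨by simpa using (mem_filter.1 hv).1, by simp; omega⟩
  · exact absurd hS (notMem_empty _)
  · exact (mem_filter.1 (mem_filter.1 hS).1).1

/-- The `i`-sets on which `F` and `G` disagree. -/
def disagree (F G : LabFam V) (k i : ℕ) : Finset (Finset V) :=
  (F.gnd.powersetCard i).filter fun S => ¬ Agree F G k S

theorem sd_partAt_subset (hF : F.Coherent) (hG : G.Coherent) (hgnd : F.gnd = G.gnd)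
    {j : ℕ} (h1 : 1 ≤ j) (hj : j ≤ k - 1) (x : Addr) (b : ℕ) :
    sd (F.partAt j x b) (G.partAt j x b) ⊆ disagree F G k j := by
  intro S hS
  simp only [sd, mem_union, mem_sdiff] at hS
  rw [disagree, mem_filter]
  rcases hS with ⟨h, h'⟩ | ⟨h, h'⟩
  · exact ⟨partAt_subset_powersetCard h1 x b h, fun ha => h' (ha.partAt hF hG hgnd hj h)⟩
  · exact ⟨hgnd ▸ partAt_subset_powersetCard h1 x b h,
      fun ha => h' (ha.symm.partAt hG hF hgnd.symm hj h)⟩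

end Agree

theorem KsetC_subset_powersetCard {W : Finset V} {cr : Finset (Finset V)} {j i : ℕ}
    (hcr : cr ⊆ W.powersetCard i) {B : Finset (Finset V)} :
    KsetC W cr j i B ⊆ W.powersetCard i := by
  rw [KsetC]
  split_ifs
  · exact (filter_subset _ _).trans hcr
  · exact filter_subset _ _

theorem cross_subset_powersetCard {i : ℕ} : F.toPartFam.cross i ⊆ F.gnd.powersetCard i :=
  filter_subset _ _

theorem Agree.KsetC (hF : F.Coherent) (hG : G.Coherent) (hgnd : F.gnd = G.gnd) {k i : ℕ}
    {S : Finset V} (h : Agree F G k S) {Q Q' : Finset (Finset V)}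
    (hQ : ∀ T ∈ Q, T ⊆ S → T ∈ Q')
    (hS : S ∈ KsetC F.gnd (F.toPartFam.cross (i+1)) i (i+1) Q) :
    S ∈ HypReg.KsetC G.gnd (G.toPartFam.cross (i+1)) i (i+1) Q' := by
  rw [HypReg.KsetC] at hS ⊢
  split_ifs at hS ⊢ with h1
  · rw [mem_filter] at hS ⊢
    exact ⟨h.cross hF hG hgnd hS.1, fun v hv => hQ _ (hS.2 v hv) (by simpa using hv)⟩
  · rw [Kset, mem_filter] at hS ⊢
    rw [← hgnd]
    exact ⟨hS.1, fun T hT => hQ T (hS.2 T hT) (mem_powersetCard.1 hT).1⟩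

theorem card_le_add_of_subset_union {α : Type*} [DecidableEq α] {A B D : Finset α}
    (h : ∀ S ∈ A, S ∉ D → S ∈ B) : (A.card : ℝ) ≤ B.card + D.card := by
  have : A ⊆ B ∪ D := fun S hS => by
    by_cases hD : S ∈ D
    · exact mem_union_right _ hD
    · exact mem_union_left _ (h S hS hD)
  exact_mod_cast (card_le_card this).trans (card_union_le _ _)

theorem regular_perturb {ε τ d β K K' q q' e e' : ℝ} (hd0 : 0 ≤ d) (hd1 : d ≤ 1) (hε : 0 < ε)
    (hε1 : ε ≤ 1) (hτ : 0 ≤ τ) (hK : |K' - K| ≤ β) (hq : |q' - q| ≤ β) (he : |e' - e| ≤ β)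
    (hbig : 3 * β ≤ τ * ε * K') (hQ : (ε + τ) * K' ≤ q') (hK0 : 0 ≤ K')
    (h : ε * K ≤ q → |e - d * q| ≤ ε * q) : |e' - d * q'| ≤ (ε + τ) * q' := by
  rw [abs_le] at hK hq he
  have hβ : 0 ≤ β := by linarith [hK.1, hK.2]
  have hτK : 3 * β ≤ τ * K' := by
    nlinarith [mul_nonneg (mul_nonneg hτ hK0) (sub_nonneg.2 hε1)]
  have hτq : 3 * β ≤ τ * q' := by
    nlinarith [mul_le_mul_of_nonneg_left hQ hτ, mul_nonneg (mul_nonneg hτ hτ) hK0]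
  have hεβ : ε * β ≤ β := by nlinarith
  have hεK : ε * K ≤ ε * K' + ε * β := by nlinarith
  have hεq : ε * q ≤ ε * q' + ε * β := by nlinarith
  have hr := abs_le.1 (h (by linarith))
  have h1 : d * (q' - q) ≤ β := by nlinarith
  have h2 : -β ≤ d * (q' - q) := by nlinarith
  rw [abs_le]
  constructor <;> linarith [hr.1, hr.2]

/-- Regularity survives passing to a family which disagrees on few sets. -/
theorem RegPairC_of_agree (hF : F.Coherent) (hG : G.Coherent) (hgnd : F.gnd = G.gnd)
    {k i : ℕ} (hi1 : 1 ≤ i) (hi : i ≤ k - 1) {ε τ d : ℝ} (hd0 : 0 ≤ d) (hd1 : d ≤ 1) (hε : 0 < ε)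
    (hε1 : ε ≤ 1) (hτ : 0 ≤ τ) {x : Addr} {A A' : Finset (Finset V)}
    (hA : ∀ S, S ∈ F.gnd.powersetCard (i+1) → Agree F G k S → (S ∈ A ↔ S ∈ A'))
    (hbig : 3 * ((disagree F G k (i+1)).card : ℝ) ≤
      τ * ε * ((F.cliq i (i+1) x).card - (disagree F G k (i+1)).card))
    (h : RegPairC F.gnd (F.toPartFam.cross (i+1)) i ε d A (F.cliq i i x)) :
    RegPairC G.gnd (G.toPartFam.cross (i+1)) i (ε + τ) d A' (G.cliq i i x) := by
  intro Q' hQ' hQK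
  have hKF := KsetC_cliq hF hi1 le_rfl x
  have hKG := KsetC_cliq hG hi1 le_rfl x
  have hag : ∀ S ∈ F.gnd.powersetCard (i+1), S ∉ disagree F G k (i+1) → Agree F G k S := by
    intro S hS hD
    rw [disagree, mem_filter] at hD
    by_contra hne
    exact hD ⟨hS, hne⟩
  set Q := Q' ∩ F.cliq i i x with hQdef
  set KF := KsetC F.gnd (F.toPartFam.cross (i+1)) i (i+1) Q with hKFdef
  set KG := KsetC G.gnd (G.toPartFam.cross (i+1)) i (i+1) Q' with hKGdef
  have hKFs : KF ⊆ F.gnd.powersetCard (i+1) := KsetC_subset_powersetCard cross_subset_powersetCard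
  have hKGs : KG ⊆ F.gnd.powersetCard (i+1) := by
    rw [hgnd]; exact KsetC_subset_powersetCard cross_subset_powersetCard
  have hFG : ∀ S ∈ KF, S ∉ disagree F G k (i+1) → S ∈ KG := fun S hS hD =>
    (hag S (hKFs hS) hD).KsetC hF hG hgnd (fun T hT _ => (mem_inter.1 hT).1) hS
  have hGF : ∀ S ∈ KG, S ∉ disagree F G k (i+1) → S ∈ KF := fun S hS hD =>
    (hag S (hKGs hS) hD).symm.KsetC hG hF hgnd.symm (fun T hT hTS => mem_inter.2 ⟨hT,
      ((hag S (hKGs hS) hD).symm.mono hTS).cliq hG hF hgnd.symm hi (hQ' hT)⟩) hS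
  have b1 := card_le_add_of_subset_union hFG
  have b2 := card_le_add_of_subset_union hGF
  have b3 := card_le_add_of_subset_union (A := A ∩ KF) (B := A' ∩ KG)
    (D := disagree F G k (i+1)) fun S hS hD => by
      rw [mem_inter] at hS ⊢
      exact ⟨(hA S (hKFs hS.2) (hag S (hKFs hS.2) hD)).1 hS.1, hFG S hS.2 hD⟩
  have b4 := card_le_add_of_subset_union (A := A' ∩ KG) (B := A ∩ KF)
    (D := disagree F G k (i+1)) fun S hS hD => by
      rw [mem_inter] at hS ⊢
      exact ⟨(hA S (hKGs hS.2) (hag S (hKGs hS.2) hD)).2 hS.1, hGF S hS.2 hD⟩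
  have b5 := card_le_add_of_subset_union (A := F.cliq i (i+1) x) (B := G.cliq i (i+1) x)
    (D := disagree F G k (i+1)) fun S hS hD =>
      (hag S (cliq_subset_powersetCard x hS) hD).cliq hF hG hgnd hi hS
  have b6 := card_le_add_of_subset_union (A := G.cliq i (i+1) x) (B := F.cliq i (i+1) x)
    (D := disagree F G k (i+1)) fun S hS hD =>
      (hag S (hgnd ▸ cliq_subset_powersetCard x hS) hD).symm.cliq hG hF hgnd.symm hi hS
  have hr := h Q inter_subset_right
  rw [hKF] at hr
  rw [hKG] at hQK
  refine regular_perturb (β := (disagree F G k (i+1)).card) hd0 hd1 hε hε1 hτ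
    (abs_le.2 ⟨?_, ?_⟩) (abs_le.2 ⟨?_, ?_⟩) (abs_le.2 ⟨?_, ?_⟩) ?_ hQK (Nat.cast_nonneg _) hr
  any_goals linarith
  refine hbig.trans (mul_le_mul_of_nonneg_left ?_ (by positivity))
  linarith

end LabFam

end

end HypReg

namespace HypReg

open Finset

attribute [local instance 10] Classical.propDecidable

noncomputable section

variable {V : Type*} [DecidableEq V]

theorem PartFam.IsFamily.cls_refines {P : PartFam V} {k : ℕ} {a : ℕ → ℕ} (h : P.IsFamily k a)
    {j : ℕ} (hj : 2 ≤ j) : j ≤ k - 1 → ∀ I ∈ P.cross j, ∀ S ∈ P.cls j I,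
      (∀ v ∈ S, ∃ u ∈ I, P.vClass v = P.vClass u) ∧
      ∀ T ⊆ S, 2 ≤ T.card → ∃ T' ⊆ I, T'.card = T.card ∧ T ∈ P.cls T.card T' := by
  obtain ⟨-, hcg, heq, -, -, hlev⟩ := h
  induction j, hj using Nat.le_induction with
  | base =>
    intro hk I hI S hS
    have hc := (hlev 2 le_rfl hk).2.2.1 I hI hS
    have hScross := (hlev 2 le_rfl hk).2.2.2.1 I hI hc
    have hIg := (mem_powersetCard.1 (mem_filter.1 hI).1)
    have hSg := (mem_powersetCard.1 (mem_filter.1 hScross).1)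
    rw [PartFam.polyCliques, KsetC, if_pos rfl, mem_filter, PartFam.polyad, if_pos rfl] at hc
    refine ⟨fun v hv => ?_, fun T hT h2 => ?_⟩
    · have := hc.2 v hv
      rw [LabFam.singleton_mem_sing, mem_sup] at this
      obtain ⟨u, hu, huv⟩ := this
      exact ⟨u, hu, heq v (hSg.1 hv) u (hIg.1 hu) huv⟩
    · have hTS : T = S := eq_of_subset_of_card_le hT (by omega)
      subst hTS
      exact ⟨I, subset_rfl, by omega, by rw [hSg.2]; exact hS⟩
  | succ j hj ih =>
    intro hk I hI S hS
    have hc := (hlev (j+1) (by omega) hk).2.2.1 I hI hS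
    have hScross := (hlev (j+1) (by omega) hk).2.2.2.1 I hI hc
    have hIg := (mem_powersetCard.1 (mem_filter.1 hI).1)
    have hSg := (mem_powersetCard.1 (mem_filter.1 hScross).1)
    rw [PartFam.polyCliques, KsetC, if_neg (by omega), Kset, mem_filter, PartFam.polyad,
      if_neg (by omega), Nat.add_sub_cancel] at hc
    have key : ∀ U ⊆ S, U.card ≤ j → ∃ T0, U ⊆ T0 ∧ ∃ I0 ⊆ I, I0 ∈ P.cross j ∧
        T0 ∈ P.cls j I0 := by
      intro U hU hUc
      obtain ⟨T0, hUT, hTS, hTc⟩ := exists_subsuperset_card_eq hU hUc (by omega)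
      have := hc.2 T0 (mem_powersetCard.2 ⟨hTS, hTc⟩)
      rw [mem_sup] at this
      obtain ⟨I0, hI0, hT0⟩ := this
      rw [mem_powersetCard] at hI0
      refine ⟨T0, hUT, I0, hI0.1, ?_, hT0⟩
      rw [PartFam.cross, mem_filter, mem_powersetCard]
      exact ⟨⟨hI0.1.trans hIg.1, hI0.2⟩, fun u hu v hv =>
        (mem_filter.1 hI).2 u (hI0.1 hu) v (hI0.1 hv)⟩
    refine ⟨fun v hv => ?_, fun T hT h2 => ?_⟩
    · obtain ⟨T0, hvT, I0, hI0, hI0c, hT0⟩ := key {v} (by simpa using hv) (by simp; omega)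
      obtain ⟨u, hu, huv⟩ := (ih (by omega) I0 hI0c T0 hT0).1 v (hvT (mem_singleton_self v))
      exact ⟨u, hI0 hu, huv⟩
    · rcases Nat.lt_or_ge j T.card with hlt | hge
      · have hTS : T = S := eq_of_subset_of_card_le hT (by omega)
        subst hTS
        exact ⟨I, subset_rfl, by omega, by rw [hSg.2]; exact hS⟩
      · obtain ⟨T0, hTT, I0, hI0, hI0c, hT0⟩ := key T hT hge
        obtain ⟨T', hT', hc', hm⟩ := (ih (by omega) I0 hI0c T0 hT0).2 T hTT h2
        exact ⟨T', hT'.trans hI0, hc', hm⟩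

namespace LabFam

/-- The family of partitions determined by vertex indices and labels. -/
def ofLabels (W : Finset V) (vIdx : V → ℕ) (lbl : ℕ → Finset V → ℕ) : LabFam V :=
  let F : LabFam V :=
    { gnd := W
      vClass := fun v => W.filter fun u => vIdx u = vIdx v
      cls := fun _ _ => ∅
      vIdx := vIdx
      lbl := lbl }
  { F with cls := fun j J => F.cliq j j (F.addrOf j J) }

theorem ofLabels_vertexCanon (W : Finset V) (vIdx : V → ℕ) (lbl : ℕ → Finset V → ℕ) :
    (ofLabels W vIdx lbl).VertexCanon := fun _ _ => rfl

theorem ofLabels_levelCanon (W : Finset V) (vIdx : V → ℕ) (lbl : ℕ → Finset V → ℕ) (j : ℕ) :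
    (ofLabels W vIdx lbl).LevelCanon j := fun _ _ => rfl

/-- The index of the class of `O` which `f` assigns to the class of `v` in `P`. -/
def pullIdx (P : PartFam V) (O : LabFam V) (f : Finset V → Finset V) (v : V) : ℕ :=
  if h : ∃ u ∈ O.gnd, f (P.vClass v) = O.vClass u then O.vIdx h.choose else 0

/-- The label of the class of `O` which `g j` assigns to the class of a `j`-set in `P`. Sets
on which the indices `i` repeat keep their label in `O`. -/
def pullLbl (P : PartFam V) (O : LabFam V) (i : V → ℕ)
    (g : ℕ → Finset (Finset V) → Finset (Finset V)) (j : ℕ) (I : Finset V) : ℕ :=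
  if Set.InjOn i I then
    if h : ∃ J ∈ O.toPartFam.cross j, g j (P.cls j I) = O.cls j J then O.lbl j h.choose else 1
  else O.lbl j I

/-- The family of partitions obtained by merging the classes of `P` along `f` and `g`. -/
def pull (P : PartFam V) (O : LabFam V) (f : Finset V → Finset V)
    (g : ℕ → Finset (Finset V) → Finset (Finset V)) : LabFam V :=
  ofLabels O.gnd (pullIdx P O f) (pullLbl P O (pullIdx P O f) g)

section pull

variable {P : PartFam V} {O : LabFam V} {f : Finset V → Finset V}
  {g : ℕ → Finset (Finset V) → Finset (Finset V)} {k : ℕ} {a aP : ℕ → ℕ}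

theorem pull_vertexCanon : (pull P O f g).VertexCanon :=
  ofLabels_vertexCanon _ _ _

theorem pull_levelCanon (j : ℕ) : (pull P O f g).LevelCanon j :=
  ofLabels_levelCanon _ _ _ j

theorem pull_coherent : (pull P O f g).Coherent :=
  pull_vertexCanon.coherent

theorem pull_vIdx_congr {u v : V} (h : P.vClass u = P.vClass v) :
    (pull P O f g).vIdx u = (pull P O f g).vIdx v := by
  show pullIdx P O f u = pullIdx P O f v
  unfold pullIdx
  rw [h]

theorem pull_cross_subset (hgnd : P.gnd = O.gnd) {j : ℕ} :
    (pull P O f g).toPartFam.cross j ⊆ P.cross j := by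
  intro S hS
  have hS' := (mem_cross pull_coherent).1 hS
  rw [PartFam.cross, mem_filter, mem_powersetCard, hgnd]
  exact ⟨⟨hS'.1, hS'.2.1⟩, fun u hu v hv hne h => hne (hS'.2.2 hu hv (pull_vIdx_congr h))⟩

theorem pull_lbl_congr {j : ℕ} {S T : Finset V} (hS : Set.InjOn (pull P O f g).vIdx S)
    (hT : Set.InjOn (pull P O f g).vIdx T) (h : P.cls j S = P.cls j T) :
    (pull P O f g).lbl j S = (pull P O f g).lbl j T := by
  show pullLbl P O (pullIdx P O f) g j S = pullLbl P O (pullIdx P O f) g j T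
  unfold pullLbl
  change Set.InjOn (pullIdx P O f) S at hS
  change Set.InjOn (pullIdx P O f) T at hT
  rw [if_pos hS, if_pos hT, h]

theorem pull_image_eq (hP : P.IsFamily k aP) {j : ℕ} (hj : 2 ≤ j)
    (hjk : j ≤ k - 1) {I S : Finset V} (hI : I ∈ P.cross j) (hS : S ∈ P.cls j I) :
    S.image (pull P O f g).vIdx = I.image (pull P O f g).vIdx := by
  have hlev := hP.2.2.2.2.2 j hj hjk
  have hSc := hlev.2.2.2.1 I hI (hlev.2.2.1 I hI hS)
  have key : ∀ A ∈ P.cross j, ∀ B ∈ P.cls j A,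
      B.image (pull P O f g).vIdx ⊆ A.image (pull P O f g).vIdx := by
    intro A hA B hB b hb
    obtain ⟨v, hv, rfl⟩ := mem_image.1 hb
    obtain ⟨u, hu, huv⟩ := (hP.cls_refines hj hjk A hA B hB).1 v hv
    exact mem_image.2 ⟨u, hu, (pull_vIdx_congr huv).symm⟩
  refine (key I hI S hS).antisymm (key S hSc I ?_)
  rw [hlev.2.1 I hI S hS]
  exact hlev.1 I hI

theorem refinesAt_pull (hP : P.IsFamily k aP) (hgnd : P.gnd = O.gnd) {j : ℕ} (hj : 1 ≤ j)
    (hjk : j ≤ k - 1) : RefinesAt P (pull P O f g).toPartFam j := by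
  have hF : (pull P O f g).Coherent := pull_coherent
  rcases Nat.eq_or_lt_of_le hj with rfl | hj
  · rw [RefinesAt, if_pos rfl]
    intro v hv u hu
    have hu' := hP.2.1 v hv hu
    have hv' : v ∈ (pull P O f g).gnd := hgnd ▸ hv
    rw [pull_vertexCanon v hv', mem_filter]
    exact ⟨hgnd ▸ hu', pull_vIdx_congr (hP.2.2.1 u hu' v hv hu)⟩
  rw [RefinesAt, if_neg (by omega)]
  intro I hI
  have hlev := hP.2.2.2.2.2 j hj hjk
  have hcross : ∀ S ∈ P.cls j I, S ∈ P.cross j := fun S hS =>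
    hlev.2.2.2.1 I hI (hlev.2.2.1 I hI hS)
  have hiff : ∀ A ∈ P.cross j, A ∈ (pull P O f g).toPartFam.cross j ↔
      (A.image (pull P O f g).vIdx).card = j := by
    intro A hA
    have hA' := mem_powersetCard.1 (mem_filter.1 hA).1
    refine ⟨card_image_of_cross hF, fun h => (mem_cross hF).2 ⟨hgnd ▸ hA'.1, hA'.2, ?_⟩⟩
    exact card_image_iff.1 (by rw [h, hA'.2])
  by_cases hI' : I ∈ (pull P O f g).toPartFam.cross j
  · left
    refine ⟨I, hI', fun S hS => ?_⟩
    have him := pull_image_eq (O := O) (f := f) (g := g) hP hj hjk hI hS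
    have hS' : S ∈ (pull P O f g).toPartFam.cross j := by
      rw [hiff S (hcross S hS), him, ← hiff I hI]
      exact hI'
    have hSi := ((mem_cross hF).1 hS').2.2
    have hIi := ((mem_cross hF).1 hI').2.2
    rw [pull_levelCanon j I hI']
    refine mem_cliq.2 ⟨hS', fun v hv => ?_, fun T hT h2 hTj => ?_⟩
    · change (pull P O f g).vIdx v ∈ I.image (pull P O f g).vIdx
      exact him ▸ mem_image_of_mem _ hv
    obtain ⟨T', hT', hc, hm⟩ := (hP.cls_refines hj hjk I hI S hS).2 T hT h2
    have hT'c : T' ∈ P.cross T.card := by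
      have := pull_cross_subset hgnd (cross_subset hF hI' hT')
      rwa [hc] at this
    have hlevT := hP.2.2.2.2.2 T.card h2 (by omega)
    have hlbl := pull_lbl_congr (O := O) (f := f) (g := g) (j := T.card)
      (hSi.mono (by exact_mod_cast hT)) (hIi.mono (by exact_mod_cast hT'))
      (hlevT.2.1 T' hT'c T hm)
    have hfit := (fits_addrOf hIi (le_refl j)).2 T' hT' (by omega) (by omega)
    rw [hc] at hfit
    change (pull P O f g).lbl T.card T = ((pull P O f g).addrOf j I).2 (T.image (pull P O f g).vIdx)
    rw [hlbl, hfit, pull_image_eq hP h2 (by omega) hT'c hm]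
  · right
    intro S hS hS'
    refine hI' ?_
    rw [hiff I hI, ← pull_image_eq hP hj hjk hI hS, ← hiff S (hcross S hS)]
    exact hS'

theorem agree_pull (hO : O.IsLabeled k a) (hgnd : P.gnd = O.gnd)
    (hf : ∀ v ∈ P.gnd, f (P.vClass v) ∈ P.gnd.image O.vClass)
    (hg : ∀ j, 2 ≤ j → j ≤ k - 1 → ∀ I ∈ P.cross j,
      g j (P.cls j I) ∈ ((O.toPartFam.cross j).image (O.cls j)) ∪
        {P.cross j \ O.toPartFam.cross j})
    {S : Finset V} (hS : S ⊆ O.gnd) (h1 : ∀ v ∈ S, v ∈ f (P.vClass v))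
    (h2 : ∀ T ⊆ S, 2 ≤ T.card → T.card ≤ k - 1 → T ∈ P.cross T.card →
      T ∈ g T.card (P.cls T.card T)) : Agree (pull P O f g) O k S := by
  have hF : (pull P O f g).Coherent := pull_coherent
  have hOc := hO.vertexCanon.coherent
  have hidx : ∀ v ∈ S, (pull P O f g).vIdx v = O.vIdx v := by
    intro v hv
    obtain ⟨u, hu, huv⟩ := mem_image.1 (hf v (hgnd ▸ hS hv))
    have hex : ∃ u ∈ O.gnd, f (P.vClass v) = O.vClass u := ⟨u, hgnd ▸ hu, huv.symm⟩
    show pullIdx P O f v = O.vIdx v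
    unfold pullIdx
    rw [dif_pos hex]
    have hmem := h1 v hv
    rw [hex.choose_spec.2] at hmem
    exact ((hOc _ (hS hv) _ hex.choose_spec.1).2
      (hO.1.2.2.1 _ (hS hv) _ hex.choose_spec.1 hmem)).symm
  refine ⟨hidx, fun T hT hT2 hTk => ?_⟩
  show pullLbl P O (pullIdx P O f) g T.card T = O.lbl T.card T
  unfold pullLbl
  split_ifs with hi hex
  · have hT' : T ∈ (pull P O f g).toPartFam.cross T.card :=
      (mem_cross hF).2 ⟨hT.trans hS, rfl, hi⟩
    have hmem := h2 T hT hT2 hTk (pull_cross_subset hgnd hT')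
    rw [hex.choose_spec.2] at hmem
    exact ((hO.2.2.2 _ hT2 hTk).2.1 _ hex.choose_spec.1 T hmem).symm
  · exfalso
    have hT' : T ∈ (pull P O f g).toPartFam.cross T.card :=
      (mem_cross hF).2 ⟨hT.trans hS, rfl, hi⟩
    have hTP := pull_cross_subset hgnd hT'
    have hTO : T ∈ O.toPartFam.cross T.card := (mem_cross hOc).2 ⟨hT.trans hS, rfl,
      Set.InjOn.congr hi fun v hv => hidx v (hT hv)⟩
    have hmem := h2 T hT hT2 hTk hTP
    rcases mem_union.1 (hg _ hT2 hTk T hTP) with h | h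
    · obtain ⟨J, hJ, hJe⟩ := mem_image.1 h
      exact hex ⟨J, hJ, hJe.symm⟩
    · rw [mem_singleton.1 h, mem_sdiff] at hmem
      exact hmem.2 hTO
  · rfl

end pull

end LabFam

end

end HypReg

namespace HypReg

open Finset

attribute [local instance 10] Classical.propDecidable

noncomputable section

variable {V : Type*} [DecidableEq V]

theorem card_filter_exists_subset_le {W : Finset V} {i r : ℕ}
    {D : Finset (Finset V)} (hD : D ⊆ W.powersetCard r) :
    ((W.powersetCard i).filter fun S => ∃ T ∈ D, T ⊆ S).card ≤
      D.card * (W.card - r).choose (i - r) := by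
  have hsub : ((W.powersetCard i).filter fun S => ∃ T ∈ D, T ⊆ S) ⊆
      D.biUnion fun T => (powersetCard (i - r) (W \ T)).image fun U => T ∪ U := by
    intro S hS
    obtain ⟨hS, T, hT, hTS⟩ := mem_filter.1 hS
    obtain ⟨hSW, hSc⟩ := mem_powersetCard.1 hS
    refine mem_biUnion.2 ⟨T, hT, mem_image.2 ⟨S \ T, ?_, union_sdiff_of_subset hTS⟩⟩
    refine mem_powersetCard.2 ⟨sdiff_subset_sdiff hSW subset_rfl, ?_⟩
    rw [card_sdiff_of_subset hTS, hSc, (mem_powersetCard.1 (hD hT)).2]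
  refine (card_le_card hsub).trans (card_biUnion_le_card_mul _ _ _ fun T hT => ?_)
  obtain ⟨hTW, hTc⟩ := mem_powersetCard.1 (hD hT)
  refine card_image_le.trans ?_
  rw [card_powersetCard, card_sdiff_of_subset hTW, hTc]

theorem card_le_of_exists_subset {W : Finset V} {i : ℕ} {ν : ℝ} (hν : 0 ≤ ν)
    {D : ℕ → Finset (Finset V)} (hD : ∀ r ∈ Icc 1 i, D r ⊆ W.powersetCard r)
    (hDc : ∀ r ∈ Icc 1 i, ((D r).card : ℝ) ≤ ν * (W.card.choose r : ℝ))
    {B : Finset (Finset V)} (hB : B ⊆ W.powersetCard i)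
    (hBD : ∀ S ∈ B, ∃ r ∈ Icc 1 i, ∃ T ∈ D r, T ⊆ S) :
    (B.card : ℝ) ≤ ν * (2 ^ i * (W.card.choose i : ℝ)) := by
  rcases Nat.lt_or_ge W.card i with hlt | hge
  · rw [powersetCard_eq_empty.2 hlt, subset_empty] at hB
    rw [hB, card_empty, Nat.cast_zero]
    positivity
  have hsub : B ⊆ (Icc 1 i).biUnion fun r =>
      (W.powersetCard i).filter fun S => ∃ T ∈ D r, T ⊆ S := fun S hS => by
    obtain ⟨r, hr, h⟩ := hBD S hS
    exact mem_biUnion.2 ⟨r, hr, mem_filter.2 ⟨hB hS, h⟩⟩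
  have h1 : (B.card : ℝ) ≤ ∑ r ∈ Icc 1 i,
      (((W.powersetCard i).filter fun S => ∃ T ∈ D r, T ⊆ S).card : ℝ) := by
    exact_mod_cast (card_le_card hsub).trans card_biUnion_le
  refine h1.trans ((sum_le_sum fun r hr => ?_ : _ ≤ ∑ r ∈ Icc 1 i,
    ν * (W.card.choose i : ℝ) * (i.choose r : ℝ)).trans ?_)
  · have h2 := card_filter_exists_subset_le (i := i) (hD r hr)
    have h3 := Nat.choose_mul (n := W.card) (k := i) (s := r) (mem_Icc.1 hr).2
    calc (((W.powersetCard i).filter fun S => ∃ T ∈ D r, T ⊆ S).card : ℝ)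
        ≤ (D r).card * ((W.card - r).choose (i - r) : ℝ) := by exact_mod_cast h2
      _ ≤ ν * (W.card.choose r : ℝ) * ((W.card - r).choose (i - r) : ℝ) := by
        gcongr
        exact hDc r hr
      _ = ν * ((W.card.choose r * (W.card - r).choose (i - r) : ℕ) : ℝ) := by
        push_cast; ring
      _ = _ := by rw [← h3]; push_cast; ring
  · rw [← mul_sum, mul_assoc, mul_comm (2 ^ i : ℝ)]
    refine mul_le_mul_of_nonneg_left (mul_le_mul_of_nonneg_left ?_ (by positivity)) hν
    have h4 : ∑ r ∈ Icc 1 i, i.choose r ≤ 2 ^ i := by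
      rw [← Nat.sum_range_choose]
      exact sum_le_sum_of_subset fun r hr => by
        have := mem_Icc.1 hr
        exact mem_range.2 (by omega)
    exact_mod_cast h4

theorem card_filter_notMem_le {α : Type*} [DecidableEq α] {s : Finset α} {c : α → Finset α}
    (f : Finset α → Finset α) (h : ∀ x ∈ s, x ∈ c x) :
    (((s.filter fun x => x ∉ f (c x)).card : ℕ) : ℝ) ≤
      ∑ C ∈ s.image c, ((C \ f C).card : ℝ) := by
  have hsub : (s.filter fun x => x ∉ f (c x)) ⊆ (s.image c).biUnion fun C => C \ f C := by
    intro x hx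
    obtain ⟨hxs, hx⟩ := mem_filter.1 hx
    exact mem_biUnion.2 ⟨c x, mem_image_of_mem _ hxs, mem_sdiff.2 ⟨h x hxs, hx⟩⟩
  exact_mod_cast (card_le_card hsub).trans card_biUnion_le

namespace LabFam

variable {P : PartFam V} {O : LabFam V} {f : Finset V → Finset V}
  {g : ℕ → Finset (Finset V) → Finset (Finset V)} {k : ℕ} {a aP : ℕ → ℕ}

theorem card_disagree_pull_le (hO : O.IsLabeled k a) (hP : P.IsFamily k aP)
    (hgnd : P.gnd = O.gnd) {ν : ℝ} (hν : 0 ≤ ν)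
    (hf : ∀ v ∈ P.gnd, f (P.vClass v) ∈ P.gnd.image O.vClass)
    (hfν : ∑ C ∈ P.gnd.image P.vClass, ((C \ f C).card : ℝ) ≤ ν * (P.gnd.card : ℝ))
    (hg : ∀ j, 2 ≤ j → j ≤ k - 1 → ∀ I ∈ P.cross j,
      g j (P.cls j I) ∈ ((O.toPartFam.cross j).image (O.cls j)) ∪
        {P.cross j \ O.toPartFam.cross j})
    (hgν : ∀ j, 2 ≤ j → j ≤ k - 1 → ∑ C ∈ (P.cross j).image (P.cls j), ((C \ g j C).card : ℝ) ≤
      ν * ((P.cross j).card : ℝ)) (i : ℕ) :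
    ((disagree (pull P O f g) O k i).card : ℝ) ≤ ν * (2 ^ i * (O.gnd.card.choose i : ℝ)) := by
  set D : ℕ → Finset (Finset V) := fun r =>
    if r = 1 then sing (P.gnd.filter fun v => v ∉ f (P.vClass v))
    else if r ≤ k - 1 then (P.cross r).filter fun T => T ∉ g r (P.cls r T) else ∅ with hDdef
  have hD1 : D 1 = sing (P.gnd.filter fun v => v ∉ f (P.vClass v)) := if_pos rfl
  have hD2 : ∀ r, 2 ≤ r → r ≤ k - 1 →
      D r = (P.cross r).filter fun T => T ∉ g r (P.cls r T) := fun r h2 hk => by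
    rw [hDdef]; dsimp only; rw [if_neg (by omega), if_pos hk]
  have hD3 : ∀ r, 2 ≤ r → ¬ r ≤ k - 1 → D r = ∅ := fun r h2 hk => by
    rw [hDdef]; dsimp only; rw [if_neg (by omega), if_neg hk]
  refine card_le_of_exists_subset hν (D := D) (fun r hr => ?_) (fun r hr => ?_)
    (filter_subset _ _) (fun S hS => ?_)
  · rcases Nat.eq_or_lt_of_le (mem_Icc.1 hr).1 with rfl | h2
    · rw [hD1]
      intro T hT
      obtain ⟨v, hv, rfl⟩ := mem_image.1 hT
      exact mem_powersetCard.2 ⟨singleton_subset_iff.2 (hgnd ▸ (mem_filter.1 hv).1),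
        card_singleton v⟩
    · by_cases hk : r ≤ k - 1
      · rw [hD2 r h2 hk, ← hgnd]
        exact (filter_subset _ _).trans (filter_subset _ _)
      · rw [hD3 r h2 hk]
        exact empty_subset _
  · rcases Nat.eq_or_lt_of_le (mem_Icc.1 hr).1 with rfl | h2
    · rw [hD1, Nat.choose_one_right, ← hgnd]
      refine le_trans ?_ ((card_filter_notMem_le f hP.1).trans hfν)
      exact_mod_cast card_image_le
    · by_cases hk : r ≤ k - 1
      · rw [hD2 r h2 hk]
        refine ((card_filter_notMem_le (g r) (hP.2.2.2.2.2 r h2 hk).1).trans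
          (hgν r h2 hk)).trans (mul_le_mul_of_nonneg_left ?_ hν)
        rw [← hgnd, ← card_powersetCard]
        exact_mod_cast card_le_card (filter_subset _ _)
      · rw [hD3 r h2 hk, card_empty, Nat.cast_zero]
        positivity
  · obtain ⟨hS, hne⟩ := mem_filter.1 hS
    have hS' := mem_powersetCard.1 hS
    by_contra! hcon
    refine hne (agree_pull hO hgnd hf hg hS'.1 (fun v hv => ?_) fun T hT h2 hk hTc => ?_)
    · by_contra hv'
      refine hcon 1 (mem_Icc.2 ⟨le_rfl, ?_⟩) {v} ?_ (singleton_subset_iff.2 hv)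
      · rw [← hS'.2]
        exact card_pos.2 ⟨v, hv⟩
      · rw [hD1, singleton_mem_sing]
        exact mem_filter.2 ⟨hgnd ▸ hS'.1 hv, hv'⟩
    · by_contra hT'
      refine hcon T.card (mem_Icc.2 ⟨by omega, ?_⟩) T ?_ hT
      · rw [← hS'.2]
        exact card_le_card hT
      · rw [hD2 _ h2 hk]
        exact mem_filter.2 ⟨hTc, hT'⟩

theorem pull_vIdx_mem (hO : O.IsLabeled k a) (hgnd : P.gnd = O.gnd)
    (hf : ∀ v ∈ P.gnd, f (P.vClass v) ∈ P.gnd.image O.vClass) :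
    ∀ v ∈ (pull P O f g).gnd,
      1 ≤ (pull P O f g).vIdx v ∧ (pull P O f g).vIdx v ≤ a 1 := by
  intro v hv
  obtain ⟨u, hu, huv⟩ := mem_image.1 (hf v (hgnd ▸ hv))
  have hex : ∃ u ∈ O.gnd, f (P.vClass v) = O.vClass u := ⟨u, hgnd ▸ hu, huv.symm⟩
  change 1 ≤ pullIdx P O f v ∧ pullIdx P O f v ≤ a 1
  unfold pullIdx
  rw [dif_pos hex]
  exact hO.2.1 _ hex.choose_spec.1

theorem pull_lbl_mem (hO : O.IsLabeled k a) (ha : ∀ j, 1 ≤ j → j ≤ k - 1 → 1 ≤ a j) :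
    ∀ j, 2 ≤ j → j ≤ k - 1 → ∀ I ∈ (pull P O f g).toPartFam.cross j,
      1 ≤ (pull P O f g).lbl j I ∧ (pull P O f g).lbl j I ≤ a j := by
  intro j h2 hk I hI
  have hinj := ((mem_cross pull_coherent).1 hI).2.2
  change Set.InjOn (pullIdx P O f) I at hinj
  change 1 ≤ pullLbl P O (pullIdx P O f) g j I ∧ pullLbl P O (pullIdx P O f) g j I ≤ a j
  unfold pullLbl
  rw [if_pos hinj]
  split_ifs with hex
  · exact (hO.2.2.2 j h2 hk).1 _ hex.choose_spec.1
  · exact ⟨le_rfl, ha j (by omega) hk⟩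

end LabFam

end

end HypReg

namespace HypReg

open Finset

attribute [local instance 10] Classical.propDecidable

noncomputable section

namespace LabFam

variable {V : Type*} [DecidableEq V] {O G : LabFam V} {k : ℕ} {a : ℕ → ℕ} {c β n : ℝ}

/-- Every polyad with a legal address spans at least `c * n ^ i` cliques on `i` vertices. -/
def ManyCliques (O : LabFam V) (k : ℕ) (a : ℕ → ℕ) (c n : ℝ) : Prop :=
  ∀ i, i ≤ k → ∀ y, Legal k a y → y.1.card = i → ∀ j, 1 ≤ j → j ≤ k - 1 →
    c * n ^ i ≤ ((O.cliq j i y).card : ℝ)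

/-- At most `β * n ^ i` sets of size `i` are labelled differently by `O` and `G`. -/
def FewDisagree (O G : LabFam V) (k : ℕ) (β n : ℝ) : Prop :=
  ∀ i, i ≤ k → ((disagree O G k i).card : ℝ) ≤ β * n ^ i

theorem disagree_comm (hgnd : O.gnd = G.gnd) (i : ℕ) :
    disagree O G k i = disagree G O k i := by
  rw [disagree, disagree, hgnd]
  exact filter_congr fun S _ => not_congr ⟨Agree.symm, Agree.symm⟩

theorem ManyCliques.exists_agree (hlow : O.ManyCliques k a c n) (hdis : FewDisagree O G k β n)
    (hn : 0 < n) (hβ : β < c) {i j : ℕ} (hik : i ≤ k) {y : Addr} (hy : Legal k a y)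
    (hyi : y.1.card = i) (hj : 1 ≤ j) (hjk : j ≤ k - 1) :
    ∃ S ∈ O.cliq j i y, Agree O G k S := by
  have h1 : ((disagree O G k i).card : ℝ) < (O.cliq j i y).card :=
    (hdis i hik).trans_lt (lt_of_lt_of_le (mul_lt_mul_of_pos_right hβ (by positivity))
      (hlow i hik y hy hyi j hj hjk))
  obtain ⟨S, hS, hS'⟩ := exists_mem_notMem_of_card_lt_card (by exact_mod_cast h1)
  refine ⟨S, hS, ?_⟩
  by_contra hcon
  exact hS' (mem_filter.2 ⟨cliq_subset_powersetCard y hS, hcon⟩)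

theorem isLabeled_of_fewDisagree (hO : O.IsLabeled k a) (hv : G.VertexCanon)
    (hc : ∀ j, 2 ≤ j → j ≤ k - 1 → G.LevelCanon j) (hgnd : O.gnd = G.gnd) (hk : 2 ≤ k)
    (hidx : ∀ v ∈ G.gnd, 1 ≤ G.vIdx v ∧ G.vIdx v ≤ a 1)
    (hlbl : ∀ j, 2 ≤ j → j ≤ k - 1 → ∀ I ∈ G.toPartFam.cross j, 1 ≤ G.lbl j I ∧ G.lbl j I ≤ a j)
    (hlow : O.ManyCliques k a c n) (hdis : FewDisagree O G k β n) (hn : 0 < n) (hβ : β < c) :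
    G.IsLabeled k a := by
  have hOc := hO.vertexCanon.coherent
  have hGc := hv.coherent
  have key : ∀ i, 1 ≤ i → i ≤ k - 1 → ∀ y, Legal k a y → y.1.card = i →
      (G.cliq i i y).Nonempty := by
    intro i h1 hik y hy hyi
    obtain ⟨S, hS, hA⟩ := hlow.exists_agree hdis hn hβ (by omega : i ≤ k) hy hyi h1 hik
    exact ⟨S, hA.cliq hOc hGc hgnd hik hS⟩
  refine isLabeled_of_canon hv hc hO.1.2.2.2.2.1 hidx hlbl (fun b hb => ?_)
    fun j h2 hjk J hJ b hb => ?_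
  · obtain ⟨S, hS⟩ := key 1 le_rfl (by omega) ({b}, fun _ => 0)
      ⟨singleton_subset_iff.2 hb, fun M hM hM2 _ => by
        have := card_le_card hM
        rw [card_singleton] at this
        omega⟩ (card_singleton b)
    obtain ⟨hScr, hfit⟩ := mem_cliq.1 hS
    have hS' := (mem_cross hGc).1 hScr
    obtain ⟨v, rfl⟩ := card_eq_one.1 hS'.2.1
    exact ⟨v, hS'.1 (mem_singleton_self v), mem_singleton.1 (hfit.1 v (mem_singleton_self v))⟩
  · have hcard := card_image_of_cross hGc hJ
    have hleg := Legal.addrOf hGc hidx hlbl hJ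
    set y : Addr := (J.image G.vIdx,
      Function.update (G.addrOf (k-1) J).2 (J.image G.vIdx) b) with hy
    obtain ⟨S, hS⟩ := key j (by omega) hjk y ⟨hleg.1, fun M hM hM2 hMk => by
        by_cases hMe : M = J.image G.vIdx
        · subst hMe
          rw [hy]
          dsimp only
          rw [Function.update_self, hcard]
          exact hb
        · rw [hy]
          dsimp only
          rw [Function.update_of_ne hMe]
          exact hleg.2 M hM hM2 hMk⟩ hcard
    have him := image_eq_of_mem_cliq hGc hS hcard
    obtain ⟨hScr, hfit⟩ := mem_cliq.1 hS
    obtain ⟨hfit', hlb⟩ := (fits_succ hGc h2 hScr).1 hfit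
    refine ⟨S, mem_cliq.2 ⟨hScr, ?_⟩, ?_⟩
    · refine hfit'.congr ((mem_cross hGc).1 hScr).2.2 him.subset fun M hM hM2 hMj => ?_
      have hMe : M ≠ J.image G.vIdx := fun h => by rw [h, hcard] at hMj; omega
      rw [him] at hM
      change Function.update (G.addrOf (k-1) J).2 (J.image G.vIdx) b M = _
      rw [Function.update_of_ne hMe]
      change (if _ then _ else _) = if _ then _ else _
      rw [if_pos ⟨hM, hM2, by omega⟩, if_pos ⟨hM, hM2, hMj⟩]
    · rw [hlb, him]
      exact Function.update_self ..

theorem ManyCliques.three_mul_le (hlow : O.ManyCliques k a c n) (hdis : FewDisagree O G k β n)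
    (hn : 0 < n) {τ ε : ℝ} (hτ : 0 ≤ τ) (hε : 0 ≤ ε) (hβ : 3 * β ≤ τ * ε * (c - β)) {i j : ℕ}
    (hik : i ≤ k) {y : Addr} (hy : Legal k a y) (hyi : y.1.card = i) (hj : 1 ≤ j)
    (hjk : j ≤ k - 1) :
    3 * ((disagree O G k i).card : ℝ) ≤
      τ * ε * ((O.cliq j i y).card - (disagree O G k i).card) := by
  have h1 := hdis i hik
  have h2 := hlow i hik y hy hyi j hj hjk
  calc 3 * ((disagree O G k i).card : ℝ) ≤ 3 * β * n ^ i := by linarith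
    _ ≤ τ * ε * (c - β) * n ^ i := mul_le_mul_of_nonneg_right hβ (by positivity)
    _ = τ * ε * (c * n ^ i - β * n ^ i) := by ring
    _ ≤ _ := mul_le_mul_of_nonneg_left (by linarith) (by positivity)

theorem polyadReg_of_fewDisagree (hO : O.IsLabeled k a) (hG : G.IsLabeled k a)
    (hgnd : O.gnd = G.gnd) (ha : ∀ j, 1 ≤ j → j ≤ k - 1 → 1 ≤ a j)
    (hlow : O.ManyCliques k a c n) (hdis : FewDisagree O G k β n) (hn : 0 < n) (hβc : β < c)
    {τ ε : ℝ} (hτ : 0 ≤ τ) (hε : 0 < ε) (hε1 : ε ≤ 1) (hβ : 3 * β ≤ τ * ε * (c - β))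
    (hreg : O.toPartFam.PolyadReg k a ε) : G.toPartFam.PolyadReg k a (ε + τ) := by
  have hOc := hO.vertexCanon.coherent
  have hGc := hG.vertexCanon.coherent
  intro K hK j h2 hjk J hJ
  obtain ⟨hJK, hJc⟩ := mem_powersetCard.1 hJ
  obtain ⟨i, rfl⟩ : ∃ i, j = i + 1 := ⟨j - 1, by omega⟩
  rw [Nat.add_sub_cancel]
  set x := G.addrOf (k-1) K with hx
  have hxl : Legal k a x := Legal.addrOf hGc hG.2.1 (fun j h2 hk => (hG.2.2.2 j h2 hk).1) hK
  have hxc : x.1.card = k := card_image_of_cross hGc hK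
  have hKi := ((mem_cross hGc).1 hK).2.2
  have hfitK : G.Fits (k-1) x K := fits_addrOf hKi le_rfl
  have hJcr : J ∈ G.toPartFam.cross (i+1) := hJc ▸ cross_subset hGc hK hJK
  have hBx : J.image G.vIdx ⊆ x.1 := image_subset_image hJK
  have hBc := card_image_of_cross hGc hJcr
  have hBl := hxl.base hBx
  have hfitJ : G.Fits i (J.image G.vIdx, x.2) J :=
    (hfitK.mono hJK (by omega)).congr (hKi.mono (by exact_mod_cast hJK)) subset_rfl
      fun _ _ _ _ => rfl
  rw [polyad_eq_cliq hG.vertexCanon (by omega) (fun h => hG.levelCanon _ h hjk) hK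
      (hfitK.mono subset_rfl hjk) rfl,
    polyad_eq_cliq hG.vertexCanon (by omega) (fun h => hG.levelCanon _ h (by omega)) hJcr
      hfitJ rfl]
  have hai : (1 : ℝ) ≤ a (i+1) := by exact_mod_cast ha _ (by omega) hjk
  refine RegPairC_of_agree hOc hGc hgnd (k := k) (by omega) (by omega) (by positivity)
    (div_le_one_of_le₀ hai (by positivity)) hε hε1 hτ (fun S _ hA => ?_)
    (hlow.three_mul_le hdis hn hτ hε.le hβ (by omega) hBl hBc (by omega) (by omega))
    (A := O.cliq (i+1) (i+1) x) ?_
  · exact ⟨hA.cliq hOc hGc hgnd hjk, hA.symm.cliq hGc hOc hgnd.symm hjk⟩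
  · have hne : (O.cliq (i + 1 - 1) x.1.card x).Nonempty := by
      obtain ⟨S, hS, -⟩ := hlow.exists_agree hdis hn hβc le_rfl hxl hxc
        (by omega : 1 ≤ i + 1 - 1) (by omega)
      exact ⟨S, hxc.symm ▸ hS⟩
    exact hO.regPairC hreg hxl h2 hjk hne hBx hBc

theorem isDensPartition_of_fewDisagree (hO : O.IsLabeled k a) (hG : G.IsLabeled k a)
    (hgnd : O.gnd = G.gnd) (hk : 2 ≤ k) {dO : Addr → ℝ} (hd : DensityFun k a dO)
    (hlow : O.ManyCliques k a c n) (hdis : FewDisagree O G k β n) (hn : 0 < n)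
    {τ ε : ℝ} (hτ : 0 ≤ τ) (hε : 0 < ε) (hε1 : ε ≤ 1) (hβ : 3 * β ≤ τ * ε * (c - β))
    {H : Finset (Finset V)} (hH : O.IsDensPartition k a ε dO H) :
    G.IsDensPartition k a (ε + τ) dO H := by
  have hOc := hO.vertexCanon.coherent
  have hGc := hG.vertexCanon.coherent
  intro x hx
  have hreg := hH x hx
  rw [polyAt_eq_cliq hOc (by omega)] at hreg
  rw [polyAt_eq_cliq hGc (by omega)]
  have hk' : k - 1 + 1 = k := by omega
  have hxc : x.1.card = k - 1 + 1 := hx.1.trans hk'.symm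
  have key := RegPairC_of_agree hOc hGc hgnd (k := k) (i := k - 1) (x := x) (A := H) (A' := H)
    (by omega) le_rfl (hd x hx).1 (hd x hx).2 hε hε1 hτ (fun _ _ _ => Iff.rfl)
    (hlow.three_mul_le hdis hn hτ hε.le hβ hk'.le (Legal.of_isAddress hx) hxc
      (by omega) le_rfl)
  rw [hk'] at key
  exact key hreg

theorem card_filter_vIdx_eq (hO : O.IsLabeled k a) {η ε : ℝ}
    (heq : O.toPartFam.IsEquitableE k a η ε) {b : ℕ} (hb : b ∈ Icc 1 (a 1)) :
    (O.gnd.filter fun v => O.vIdx v = b).card = O.gnd.card / a 1 ∨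
      (O.gnd.filter fun v => O.vIdx v = b).card = O.gnd.card / a 1 + 1 := by
  obtain ⟨v, hv, rfl⟩ := hO.exists_vIdx hb
  rw [← hO.vertexCanon v hv]
  exact heq.2.1 v hv

theorem abs_card_filter_sub_le (hgnd : O.gnd = G.gnd) (b : ℕ) :
    |((O.gnd.filter fun v => O.vIdx v = b).card : ℝ) -
      ((G.gnd.filter fun v => G.vIdx v = b).card : ℝ)| ≤ (disagree O G k 1).card := by
  set D := O.gnd.filter fun v => O.vIdx v ≠ G.vIdx v with hD
  have hDc : (D.card : ℝ) ≤ (disagree O G k 1).card := by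
    have h : (sing D).card ≤ (disagree O G k 1).card := by
      refine card_le_card fun S hS => ?_
      obtain ⟨v, hv, rfl⟩ := mem_image.1 hS
      obtain ⟨hv, hne⟩ := mem_filter.1 hv
      exact mem_filter.2 ⟨mem_powersetCard.2 ⟨singleton_subset_iff.2 hv, card_singleton v⟩,
        fun hA => hne (hA.1 v (mem_singleton_self v))⟩
    rw [sing, card_image_of_injective _ singleton_injective] at h
    exact_mod_cast h
  have h1 := card_le_add_of_subset_union (A := O.gnd.filter fun v => O.vIdx v = b)
    (B := G.gnd.filter fun v => G.vIdx v = b) (D := D) fun v hv hvD => by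
      obtain ⟨hv, hvb⟩ := mem_filter.1 hv
      have : O.vIdx v = G.vIdx v := by
        by_contra h
        exact hvD (mem_filter.2 ⟨hv, h⟩)
      exact mem_filter.2 ⟨hgnd ▸ hv, this ▸ hvb⟩
  have h2 := card_le_add_of_subset_union (A := G.gnd.filter fun v => G.vIdx v = b)
    (B := O.gnd.filter fun v => O.vIdx v = b) (D := D) fun v hv hvD => by
      obtain ⟨hv, hvb⟩ := mem_filter.1 hv
      have : O.vIdx v = G.vIdx v := by
        by_contra h
        exact hvD (mem_filter.2 ⟨hgnd ▸ hv, h⟩)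
      exact mem_filter.2 ⟨hgnd ▸ hv, this.symm ▸ hvb⟩
  rw [abs_sub_le_iff]
  constructor <;> linarith

theorem abs_card_vClass_sub_le (hO : O.IsLabeled k a) (hG : G.IsLabeled k a)
    (hgnd : O.gnd = G.gnd) {η ε : ℝ} (heq : O.toPartFam.IsEquitableE k a η ε) (ha : 1 ≤ a 1)
    {v : V} (hv : v ∈ G.gnd) :
    |((G.vClass v).card : ℝ) - (G.gnd.card : ℝ) / (a 1 : ℝ)| ≤ 1 + (disagree O G k 1).card := by
  rw [hG.vertexCanon v hv]
  have h1 := abs_card_filter_sub_le (k := k) hgnd (G.vIdx v)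
  have h2 := card_filter_vIdx_eq hO heq (mem_Icc.2 (hG.2.1 v hv))
  rw [hgnd] at h2
  have ha' : (0 : ℝ) < a 1 := by exact_mod_cast ha
  have h3 : ((G.gnd.card / a 1 : ℕ) : ℝ) ≤ (G.gnd.card : ℝ) / (a 1 : ℝ) := Nat.cast_div_le
  have h4 : (G.gnd.card : ℝ) / (a 1 : ℝ) ≤ ((G.gnd.card / a 1 : ℕ) : ℝ) + 1 := by
    rw [div_le_iff₀ ha']
    have := Nat.lt_div_mul_add (a := G.gnd.card) (b := a 1) ha
    have h5 : (G.gnd.card : ℝ) ≤ ((G.gnd.card / a 1 : ℕ) : ℝ) * a 1 + a 1 := by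
      exact_mod_cast this.le
    linarith
  rw [hgnd] at h1
  rw [abs_le] at h1 ⊢
  rcases h2 with h | h <;> rw [h] at h1 <;> push_cast at h1 <;> constructor <;> linarith

end LabFam

end

end HypReg

namespace HypReg

open Finset

attribute [local instance 10] Classical.propDecidable

namespace LabFam

theorem IsLabeled.manyCliques {V : Type} [DecidableEq V] {F : LabFam V}
    {eCL : ℝ → ℝ → ℕ → ℕ → ℝ} {mCL : ℝ → ℝ → ℕ → ℕ → ℕ}
    (hCL : CountingProp eCL mCL) {k t m : ℕ} {ε c : ℝ} {a : ℕ → ℕ}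
    (h : F.IsLabeled k a) (hpr : F.toPartFam.PolyadReg k a ε)
    (hk : 2 ≤ k) (ht : 2 ≤ t)
    (hε : 0 < ε) (hεt : 3 ≤ k → ε ≤ eCL (1 / (t : ℝ)) (1 / (t : ℝ)) (k-1) k)
    (ha : ∀ i, 1 ≤ i → i ≤ k - 1 → 1 ≤ a i ∧ a i ≤ t)
    (hm5 : 5 ≤ m) (hmt : 3 ≤ k → mCL (1 / (t : ℝ)) (1 / (t : ℝ)) (k-1) k ≤ m)
    (hm : ∀ b ∈ Icc 1 (a 1), (F.gnd.filter fun v => F.vIdx v = b).card = m ∨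
      (F.gnd.filter fun v => F.vIdx v = b).card = m + 1) (hn : 0 < F.gnd.card)
    (hc : c * (F.gnd.card : ℝ) ^ k ≤ 1 / 2 * ((1 / (t : ℝ)) ^ (2 ^ k) * (m : ℝ) ^ k)) :
    F.ManyCliques k a c F.gnd.card := by
  intro i hik y hy hyi j hj hjk
  obtain ⟨z, hz, hzc, hyz, hlab⟩ := hy.extend (hyi ▸ hik) h.1.2.2.2.2.1
    fun j h1 h2 => (ha j h1 h2).1
  have h1 := h.le_card_cliq hCL hpr hz hk ht hzc hε hεt
    (fun i h2 hk => ha i (by omega) hk) hm5 hmt (fun b hb => hm b (hz.1 hb)) hj hjk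
  have h2 := card_cliq_le_mul_pow h.vertexCanon.coherent (le_refl j) hzc hyi hyz hlab
  have h3 : ((F.cliq j k z).card : ℝ) ≤
      ((F.cliq j i y).card : ℝ) * (F.gnd.card : ℝ) ^ (k - i) := by exact_mod_cast h2
  have hn' : (0 : ℝ) < F.gnd.card := by exact_mod_cast hn
  refine le_of_mul_le_mul_right ?_ (pow_pos hn' (k - i))
  rw [mul_assoc, ← pow_add, Nat.add_sub_cancel' hik]
  linarith

end LabFam

theorem exists_approx_bound {ε₀ c T : ℝ} (hε : 0 < ε₀) (hε1 : ε₀ ≤ 1) (hc : 0 < c) (hc1 : c ≤ 1)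
    (hT : 1 ≤ T) (k : ℕ) :
    ∃ ν₀ : ℝ, 0 < ν₀ ∧ ∀ ν : ℝ, 0 < ν → ν ≤ ν₀ →
      2 ^ k * ν ≤ ν ^ ((1:ℝ)/2) ∧ 2 ^ k * ν < c ∧
      3 * (2 ^ k * ν) ≤ ν ^ ((1:ℝ)/20) * ε₀ * (c - 2 ^ k * ν) ∧
      2 ^ k * ν ≤ ν ^ ((1:ℝ)/20) / (2 * T) := by
  have hk : (1 : ℝ) ≤ 2 ^ k := one_le_pow₀ (by norm_num)
  have hεc : ε₀ * c ≤ 1 := mul_le_one₀ hε1 hc.le hc1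
  set δ : ℝ := ε₀ * c / (8 * 2 ^ k * T) with hδ
  have hδ0 : 0 < δ := by positivity
  have hkT : 8 ≤ 8 * 2 ^ k * T := by nlinarith [mul_le_mul hk hT zero_le_one (by positivity)]
  have hδ1 : δ ≤ 1 := by
    rw [hδ, div_le_one (by positivity)]
    linarith
  refine ⟨δ ^ 2, by positivity, fun ν hν hνδ => ?_⟩
  set s := ν ^ ((1:ℝ)/2) with hs
  set τ := ν ^ ((1:ℝ)/20) with hτ
  have hν1 : ν ≤ 1 := hνδ.trans (pow_le_one₀ hδ0.le hδ1)
  have hs0 : 0 < s := Real.rpow_pos_of_pos hν _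
  have hτ0 : 0 < τ := Real.rpow_pos_of_pos hν _
  have hss : s * s = ν := by
    rw [hs, ← Real.rpow_add hν]
    norm_num
  have hsδ : s ≤ δ := by
    by_contra! hcon
    nlinarith
  have hsτ : s ≤ τ := Real.rpow_le_rpow_of_exponent_ge hν hν1 (by norm_num)
  have hkey : 2 ^ k * ν ≤ ε₀ * c / (8 * T) * s := by
    have : 2 ^ k * δ = ε₀ * c / (8 * T) := by
      rw [hδ]
      field_simp
    rw [← this, ← hss, ← mul_assoc]
    gcongr
  have h8 : ε₀ * c / (8 * T) ≤ ε₀ * c / 8 :=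
    div_le_div_of_nonneg_left (by positivity) (by norm_num) (by linarith)
  have hkey2 : 2 ^ k * ν ≤ ε₀ * c / 8 * s := hkey.trans (by gcongr)
  have hc8 : 2 ^ k * ν ≤ c / 8 := by
    refine hkey2.trans ?_
    have h1 : ε₀ * c / 8 ≤ c / 8 := by nlinarith
    calc ε₀ * c / 8 * s ≤ c / 8 * 1 :=
          mul_le_mul h1 (hsδ.trans hδ1) hs0.le (by positivity)
      _ = c / 8 := mul_one _
  refine ⟨?_, by linarith, ?_, ?_⟩
  · refine hkey2.trans (mul_le_of_le_one_left hs0.le ?_)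
    linarith
  · calc 3 * (2 ^ k * ν) ≤ 3 * (ε₀ * c / 8 * τ) := by
          refine mul_le_mul_of_nonneg_left (hkey2.trans ?_) (by norm_num)
          gcongr
      _ ≤ τ * ε₀ * (7 / 8 * c) := by
          have : 0 < τ * ε₀ * c := by positivity
          linarith
      _ ≤ _ := mul_le_mul_of_nonneg_left (by linarith) (by positivity)
  · calc 2 ^ k * ν ≤ ε₀ * c / (8 * T) * τ := hkey.trans (by gcongr)
      _ ≤ 1 / (2 * T) * τ := by
        refine mul_le_mul_of_nonneg_right ?_ hτ0.le
        exact div_le_div₀ zero_le_one hεc (by positivity) (by linarith)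
      _ = τ / (2 * T) := by ring

theorem GoodERI.exists_bound {eRI : ℕ → ℕ → ℝ} (h : GoodERI eRI) (k : ℕ) {ε : ℝ} (hε : 0 < ε) :
    ∃ T : ℕ, 1 ≤ T ∧ ∀ (a : ℕ → ℕ) (d : Addr → ℝ), RegInstance eRI k ε a d → maxA k a ≤ T := by
  obtain ⟨T, hT⟩ := Filter.eventually_atTop.1 ((h.2.2.2.1 k).eventually_lt_const hε)
  refine ⟨T + 1, by omega, fun a d hr => ?_⟩
  by_contra! hcon
  exact absurd (hT (maxA k a) (by omega)) (not_lt.2 hr.2.2.2.1)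

theorem two_mul_le_of_le_div {ε e : ℝ} {t N : ℕ} (ht : 1 ≤ t) (he : 0 ≤ e)
    (h : ε < e / (4 * (t : ℝ) ^ N)) : 2 * ε ≤ e := by
  have h1 : (1 : ℝ) ≤ (t : ℝ) ^ N := one_le_pow₀ (by exact_mod_cast ht)
  have h2 : e / (4 * (t : ℝ) ^ N) ≤ e / 2 :=
    div_le_div_of_nonneg_left he (by norm_num) (by linarith)
  linarith

theorem pow_bound {k t T m n : ℕ} (ht : 1 ≤ t) (htT : t ≤ T)
    (hmn : (n : ℝ) ≤ 2 * T * m) :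
    1 / 2 * (1 / (T : ℝ)) ^ (2 ^ k) * (1 / (2 * T : ℝ)) ^ k * (n : ℝ) ^ k ≤
      1 / 2 * ((1 / (t : ℝ)) ^ (2 ^ k) * (m : ℝ) ^ k) := by
  have ht0 : (0 : ℝ) < t := by exact_mod_cast ht
  have hT0 : (0 : ℝ) < T := by exact_mod_cast ht.trans htT
  have h1 : (1 / (T : ℝ)) ^ (2 ^ k) ≤ (1 / (t : ℝ)) ^ (2 ^ k) := by
    gcongr
  have h2 : (1 / (2 * T : ℝ)) ^ k * (n : ℝ) ^ k ≤ (m : ℝ) ^ k := by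
    rw [← mul_pow]
    refine pow_le_pow_left₀ (by positivity) ?_ k
    rw [one_div, inv_mul_le_iff₀ (by positivity)]
    exact hmn
  calc _ = 1 / 2 * ((1 / (T : ℝ)) ^ (2 ^ k) * ((1 / (2 * T : ℝ)) ^ k * (n : ℝ) ^ k)) := by ring
    _ ≤ _ := by gcongr

end HypReg

namespace HypReg

open Finset

/-- Reconstruction lemma (Lemma 5.3 of the paper): turning an approximate refinement into an
exact one while almost preserving the equitable partition. -/
theorem reconstruction_lemma (eRI : ℕ → ℕ → ℝ) (hERI : GoodERI eRI) :
    ∀ k : ℕ, 2 ≤ k → ∀ ε₀ : ℝ, 0 < ε₀ → ε₀ ≤ 1 →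
    ∃ ν₀ : ℝ, 0 < ν₀ ∧ ∀ ν : ℝ, 0 < ν → ν ≤ ν₀ →
    ∃ ε₁ : ℝ, 0 < ε₁ ∧ ∀ ε : ℝ, 0 < ε → ε ≤ ε₁ →
    ∃ n₀ : ℕ, ∀ (V : Type) [DecidableEq V], ∀ (W : Finset V) (n : ℕ),
    W.card = n → n₀ ≤ n →
    ∀ (aO : ℕ → ℕ) (dO : Addr → ℝ), RegInstance eRI k (ε₀ / 2) aO dO →
    ∀ Hk : Finset (Finset V), IsKGraph W k Hk →
    ∀ O : LabFam V, O.gnd = W → O.IsEquitPartition k aO ε₀ dO Hk →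
    ∀ (η : ℝ) (aP : ℕ → ℕ) (P : PartFam V), 0 < η → P.gnd = W →
    P.IsFamily k aP → P.IsEquitableE k aP η ε →
    (∀ j, 1 ≤ j → j ≤ k - 1 → RefinesApproxAt P O.toPartFam j ν) →
    ∃ O' : LabFam V, O'.gnd = W ∧ O'.IsLabeled k aO ∧
      -- (O'1)
      (∀ j, 1 ≤ j → j ≤ k - 1 → RefinesAt P O'.toPartFam j) ∧
      -- (O'2)
      O'.toPartFam.IsEquitable k aO (1 / (aO 1 : ℝ)) (ε₀ + ν ^ ((1:ℝ)/20)) (ν ^ ((1:ℝ)/20)) ∧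
      O'.IsDensPartition k aO (ε₀ + ν ^ ((1:ℝ)/20)) dO Hk ∧
      -- (O'3)
      ∀ j, 1 ≤ j → j ≤ k - 1 → ∀ (x : Addr) (b : ℕ),
        IsAddress j (j-1) aO x → 1 ≤ b → b ≤ aO j →
        ((sd (O'.partAt j x b) (O.partAt j x b)).card : ℝ)
          ≤ ν ^ ((1:ℝ)/2) * (n.choose j : ℝ) := by
  intro k hk ε₀ hε₀ hε₁
  obtain ⟨T, hT1, hT⟩ := hERI.exists_bound k (half_pos hε₀)
  obtain ⟨eCL, mCL, hCL, hCLb⟩ := hERI.2.2.2.2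
  have hT1' : (1 : ℝ) ≤ T := by exact_mod_cast hT1
  set c : ℝ := 1 / 2 * (1 / (T : ℝ)) ^ (2 ^ k) * (1 / (2 * T : ℝ)) ^ k with hc
  have hc0 : 0 < c := by positivity
  have hc1 : c ≤ 1 := by
    have h1 : (1 / (T : ℝ)) ^ (2 ^ k) ≤ 1 :=
      pow_le_one₀ (by positivity) (div_le_one_of_le₀ hT1' (by positivity))
    have h2 : (1 / (2 * T : ℝ)) ^ k ≤ 1 :=
      pow_le_one₀ (by positivity) (div_le_one_of_le₀ (by linarith) (by positivity))
    exact mul_le_one₀ (mul_le_one₀ (by norm_num) (by positivity) h1) (by positivity) h2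
  obtain ⟨ν₀, hν₀, hbound⟩ := exists_approx_bound hε₀ hε₁ hc0 hc1 hT1' k
  refine ⟨ν₀, hν₀, fun ν hν hνν₀ => ⟨1, one_pos, fun ε _ _ => ?_⟩⟩
  obtain ⟨hb1, hb2, hb3, hb4⟩ := hbound ν hν hνν₀
  set τ : ℝ := ν ^ ((1:ℝ)/20) with hτ
  have hτ0 : 0 < τ := Real.rpow_pos_of_pos hν _
  set M : ℕ := 5 + ∑ t ∈ range (T + 1), mCL (1 / (t : ℝ)) (1 / (t : ℝ)) (k-1) k with hM
  refine ⟨⌈2 * T / τ⌉₊ + M * T, fun V _ W n hW hn aO dO hR Hk _ O hOW hO η aP P _ hPW hP _ hPO =>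
    ?_⟩
  obtain ⟨-, ha, -, hεR, hdO⟩ := id hR
  obtain ⟨hOl, hOe, hOd⟩ := hO
  set t := maxA k aO with ht
  have htT : t ≤ T := hT aO dO hR
  have hat : ∀ j, 1 ≤ j → j ≤ k - 1 → aO j ≤ t := fun j h1 h2 =>
    le_sup (f := aO) (mem_Icc.2 ⟨h1, h2⟩)
  have hka : k ≤ aO 1 := hOl.1.2.2.2.2.1
  have hat1 := hat 1 le_rfl (by omega)
  have ht2 : 2 ≤ t := by omega
  have hgO : O.gnd.card = n := by rw [hOW, hW]
  have hPO' : P.gnd = O.gnd := hPW.trans hOW.symm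
  have haO : (1 : ℝ) ≤ aO 1 := by exact_mod_cast ha 1 le_rfl (by omega)
  have haOT : (aO 1 : ℝ) ≤ T := by exact_mod_cast hat1.trans htT
  -- sizes of the vertex classes
  have hMm : M ≤ n / aO 1 := by
    rw [Nat.le_div_iff_mul_le (by omega)]
    calc M * aO 1 ≤ M * T := Nat.mul_le_mul_left _ (hat1.trans htT)
      _ ≤ n := by omega
  have hM5 : 5 ≤ M := by omega
  have hn0 : 0 < n := by
    rcases Nat.eq_zero_or_pos n with h | h
    · rw [h, Nat.zero_div] at hMm
      omega
    · exact h
  have hn0' : (0 : ℝ) < n := by exact_mod_cast hn0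
  have hnm : (n : ℝ) ≤ 2 * T * (n / aO 1 : ℕ) := by
    have h1 := (Nat.lt_div_mul_add (a := n) (b := aO 1) (by omega)).le
    have h2 : aO 1 ≤ T := hat1.trans htT
    have h3 : n ≤ 2 * T * (n / aO 1) := by nlinarith
    exact_mod_cast h3
  have hnτ : 1 ≤ τ * n / (2 * T) := by
    have h1 : (⌈2 * T / τ⌉₊ : ℝ) ≤ n := by exact_mod_cast (by omega : ⌈2 * T / τ⌉₊ ≤ n)
    have h2 := (div_le_iff₀ hτ0).1 ((Nat.le_ceil _).trans h1)
    rw [le_div_iff₀ (by positivity)]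
    linarith
  -- counting cliques
  have hεt : 3 ≤ k → ε₀ ≤ eCL (1 / (t : ℝ)) (1 / (t : ℝ)) (k-1) k := by
    intro h3
    have ht0 : (0 : ℝ) < 1 / (t : ℝ) := by
      have : (0 : ℝ) < t := by exact_mod_cast (by omega : 0 < t)
      positivity
    have h1 := (hCL _ _ ht0 ht0 (k-1) k (by omega) (by omega)).1.1
    have h2 := two_mul_le_of_le_div (by omega) h1.le (hεR.trans_lt (hCLb t k (by omega) hk))
    linarith
  have hmt : mCL (1 / (t : ℝ)) (1 / (t : ℝ)) (k-1) k ≤ n / aO 1 := by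
    have := single_le_sum (f := fun t : ℕ => mCL (1 / (t : ℝ)) (1 / (t : ℝ)) (k-1) k)
      (fun _ _ => Nat.zero_le _) (mem_range.2 (by omega : t < T + 1))
    omega
  have hlow : O.ManyCliques k aO c n := by
    rw [← hgO]
    refine hOl.manyCliques hCL hOe.2.2 hk ht2 hε₀ hεt (fun i h1 h2 => ⟨ha i h1 h2, hat i h1 h2⟩)
      (hM5.trans hMm) (fun _ => hmt)
      (fun b hb => hgO ▸ LabFam.card_filter_vIdx_eq hOl hOe hb) (by omega) ?_
    rw [hgO]
    exact pow_bound (by omega) htT hnm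
  -- the family of partitions obtained from the approximate refinement
  obtain ⟨f, hf, hfν⟩ : ∃ f : Finset V → Finset V,
      (∀ v ∈ P.gnd, f (P.vClass v) ∈ P.gnd.image O.vClass) ∧
      ∑ C ∈ P.gnd.image P.vClass, ((C \ f C).card : ℝ) ≤ ν * (P.gnd.card : ℝ) := by
    have h := hPO 1 le_rfl (by omega)
    rwa [RefinesApproxAt, if_pos rfl] at h
  have hgex : ∀ j, ∃ g : Finset (Finset V) → Finset (Finset V), 2 ≤ j → j ≤ k - 1 →
      (∀ I ∈ P.cross j, g (P.cls j I) ∈ ((O.toPartFam.cross j).image (O.cls j)) ∪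
        {P.cross j \ O.toPartFam.cross j}) ∧
      ∑ C ∈ (P.cross j).image (P.cls j), ((C \ g C).card : ℝ) ≤ ν * ((P.cross j).card : ℝ) := by
    intro j
    by_cases hj : 2 ≤ j ∧ j ≤ k - 1
    · have h := hPO j (by omega) hj.2
      rw [RefinesApproxAt, if_neg (by omega)] at h
      obtain ⟨g, hg⟩ := h
      exact ⟨g, fun _ _ => hg⟩
    · exact ⟨id, fun h1 h2 => absurd ⟨h1, h2⟩ hj⟩
  choose g hg using hgex
  have hdis := LabFam.card_disagree_pull_le hOl hP hPO' hν.le hf hfν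
    (fun j h1 h2 => (hg j h1 h2).1) fun j h1 h2 => (hg j h1 h2).2
  have hgnd : O.gnd = (LabFam.pull P O f g).gnd := rfl
  have hpow : ∀ i, i ≤ k → (2 : ℝ) ^ i ≤ 2 ^ k := fun i hi =>
    pow_le_pow_right₀ (by norm_num) hi
  have hfew : LabFam.FewDisagree O (LabFam.pull P O f g) k (2 ^ k * ν) n := by
    intro i hi
    rw [LabFam.disagree_comm hgnd]
    have h1 : ((n.choose i : ℕ) : ℝ) ≤ (n : ℝ) ^ i := by exact_mod_cast Nat.choose_le_pow n i
    calc _ ≤ ν * (2 ^ i * (O.gnd.card.choose i : ℝ)) := hdis i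
      _ ≤ ν * (2 ^ k * (n : ℝ) ^ i) := by
        rw [hgO]
        exact mul_le_mul_of_nonneg_left (mul_le_mul (hpow i hi) h1 (by positivity)
          (by positivity)) hν.le
      _ = _ := by ring
  have hGl : (LabFam.pull P O f g).IsLabeled k aO :=
    LabFam.isLabeled_of_fewDisagree hOl LabFam.pull_vertexCanon
      (fun j _ _ => LabFam.pull_levelCanon j) hgnd hk (LabFam.pull_vIdx_mem hOl hPO' hf)
      (LabFam.pull_lbl_mem hOl ha) hlow hfew hn0' hb2
  refine ⟨LabFam.pull P O f g, hOW, hGl, fun j h1 h2 => LabFam.refinesAt_pull hP hPO' h1 h2,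
    ⟨?_, fun v hv => ?_, LabFam.polyadReg_of_fewDisagree hOl hGl hgnd ha hlow hfew hn0' hb2
      hτ0.le hε₀ hε₁ hb3 hOe.2.2⟩,
    LabFam.isDensPartition_of_fewDisagree hOl hGl hgnd hk hdO hlow hfew hn0' hτ0.le hε₀ hε₁ hb3
      hOd, fun j h1 h2 x b _ _ _ => ?_⟩
  · rw [one_div, inv_mul_cancel₀ (by positivity)]
  · refine (LabFam.abs_card_vClass_sub_le hOl hGl hgnd hOe (by omega) hv).trans ?_
    have hd1 := hfew 1 (by omega)
    rw [pow_one] at hd1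
    have h3 : 2 ^ k * ν * n ≤ τ / (2 * T) * n := mul_le_mul_of_nonneg_right hb4 hn0'.le
    have h4 : τ * n / T ≤ τ * n / aO 1 :=
      div_le_div_of_nonneg_left (by positivity) (by positivity) haOT
    have h5 : τ / (2 * T) * n + τ * n / (2 * T) = τ * n / T := by
      field_simp
      ring
    rw [← hgnd, hgO]
    linarith
  · have h3 := LabFam.sd_partAt_subset hGl.vertexCanon.coherent hOl.vertexCanon.coherent
      hgnd.symm h1 h2 x b
    calc _ ≤ ((LabFam.disagree (LabFam.pull P O f g) O k j).card : ℝ) := by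
          exact_mod_cast card_le_card h3
      _ ≤ ν * (2 ^ j * (n.choose j : ℝ)) := hgO ▸ hdis j
      _ ≤ ν * (2 ^ k * (n.choose j : ℝ)) := by
        gcongr
        · norm_num
        · omega
      _ = 2 ^ k * ν * (n.choose j : ℝ) := by ring
      _ ≤ _ := mul_le_mul_of_nonneg_right hb1 (by positivity)

end HypReg
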